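/- arXiv:2207.01087 — 2 statements merged into one kernel-verified Lean document; each statement's English description precedes it below -/
import Mathlib

section
/- Let 0 ≤ λ < ∞, 0 < p < ∞, 1 < q < ∞, −n/q + λ < α < n(1−1/q), and b ∈ BMO(ℝⁿ). The maximal commutator M_b f(x) = sup_{r>0} |B(x,r)|^{-1} ∫_{B(x,r)} |b(x)−b(y)||f(y)| dy, which is bounded on L^q(ℝⁿ), is also bounded on the Herz–Morrey space M K̇^{α,λ}_{p,q}(ℝⁿ): ‖M_b f‖_{M K̇^{α,λ}_{p,q}} ≤ C‖b‖_{BMO}‖f‖_{M K̇^{α,λ}_{p,q}}. -/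
open MeasureTheory ENNReal

/-- The dyadic annulus `A_k = {x : 2^(k-1) < |x| ≤ 2^k}` in `ℝⁿ`. -/
def annulus (n : ℕ) (k : ℤ) : Set (EuclideanSpace ℝ (Fin n)) :=
  {x | (2:ℝ) ^ (k - 1) < ‖x‖ ∧ ‖x‖ ≤ (2:ℝ) ^ k}

/-- The homogeneous Herz–Morrey quasi-norm
`‖f‖ = sup_{k₀∈ℤ} 2^{-k₀λ} (∑_{k≤k₀} 2^{kαp} ‖f χ_{A_k}‖_{L^q}^p)^{1/p}`. -/
noncomputable def herzMorreyNorm (n : ℕ) (α lam p q : ℝ)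
    (f : EuclideanSpace ℝ (Fin n) → ℝ) : ℝ≥0∞ :=
  ⨆ k₀ : ℤ, (2:ℝ≥0∞) ^ (-(k₀:ℝ) * lam) *
    (∑' k : {k : ℤ // k ≤ k₀}, (2:ℝ≥0∞) ^ ((k.1:ℝ) * α * p) *
      eLpNorm ((annulus n k.1).indicator f) (ENNReal.ofReal q) volume ^ p) ^ (1/p)

/-- The maximal commutator `M_b f(x) = sup_{r>0} |B(x,r)|⁻¹ ∫_{B(x,r)} |b(x)-b(y)||f(y)| dy`. -/
noncomputable def maxComm (n : ℕ) (b f : EuclideanSpace ℝ (Fin n) → ℝ)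
    (x : EuclideanSpace ℝ (Fin n)) : ℝ :=
  ⨆ r : {r : ℝ // 0 < r}, ((volume (Metric.ball x r.1)).toReal)⁻¹ *
    ∫ y in Metric.ball x r.1, |b x - b y| * |f y|


theorem aux_sup_trick {ι : Type*} (c a : ι → ℝ≥0∞) {p : ℝ} (hp : 0 < p) :
    (∑' d, c d * a d) ^ p ≤ (∑' d, c d) ^ p * ∑' d, (a d) ^ p := by
  have h1 : ∑' d, c d * a d ≤ (∑' d, c d) * (∑' d, (a d) ^ p) ^ (1/p) := by
    rw [← ENNReal.tsum_mul_right]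
    refine ENNReal.tsum_le_tsum fun d => ?_
    gcongr
    calc a d = (a d ^ p) ^ (1/p) := by
          rw [← ENNReal.rpow_mul, mul_one_div_cancel hp.ne', ENNReal.rpow_one]
      _ ≤ _ := by
          gcongr
          exact ENNReal.le_tsum d
  calc (∑' d, c d * a d) ^ p ≤ ((∑' d, c d) * (∑' d, (a d) ^ p) ^ (1/p)) ^ p := by gcongr
    _ = _ := by
      rw [ENNReal.mul_rpow_of_nonneg _ _ hp.le, ← ENNReal.rpow_mul, one_div_mul_cancel hp.ne',
        ENNReal.rpow_one]

theorem aux_two_rpow (x : ℝ) : (2:ℝ≥0∞) ^ x = ENNReal.ofReal ((2:ℝ) ^ x) := by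
  rw [← ENNReal.ofReal_rpow_of_pos (by norm_num)]; simp

theorem aux_two_add (x y : ℝ) : (2:ℝ≥0∞) ^ (x + y) = 2 ^ x * 2 ^ y :=
  ENNReal.rpow_add _ _ (by norm_num) (by norm_num)

theorem aux_two_ne_top (x : ℝ) : (2:ℝ≥0∞) ^ x ≠ ⊤ := by
  rw [aux_two_rpow]; exact ENNReal.ofReal_ne_top

theorem aux_two_ne_zero (x : ℝ) : (2:ℝ≥0∞) ^ x ≠ 0 := by
  rw [aux_two_rpow]; simp; positivity

theorem aux_summable {δ : ℝ} (hδ : 0 < δ) :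
    ∑' d : ℤ, (1 + ENNReal.ofReal |(d:ℝ)|) * (2:ℝ≥0∞) ^ (-(δ * |(d:ℝ)|)) ≠ ⊤ := by
  have hs : Summable fun d : ℤ => (1 + |(d:ℝ)|) * (2:ℝ) ^ (-(δ * |(d:ℝ)|)) := by
    have hr : ‖(2:ℝ) ^ (-δ)‖ < 1 := by
      rw [Real.norm_of_nonneg (by positivity)]
      exact Real.rpow_lt_one_of_one_lt_of_neg (by norm_num) (by linarith)
    have h0 : Summable fun m : ℕ => (1 + (m:ℝ)) * (2:ℝ) ^ (-(δ * (m:ℝ))) := by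
      have e : (fun m : ℕ => (1 + (m:ℝ)) * (2:ℝ) ^ (-(δ * (m:ℝ)))) =
          fun m : ℕ => ((2:ℝ) ^ (-δ)) ^ m + (m:ℝ) ^ 1 * ((2:ℝ) ^ (-δ)) ^ m := by
        funext m
        have : (2:ℝ) ^ (-(δ * (m:ℝ))) = ((2:ℝ) ^ (-δ)) ^ m := by
          rw [← Real.rpow_natCast, ← Real.rpow_mul (by norm_num)]; ring_nf
        rw [this]; ring
      rw [e]
      exact (summable_geometric_of_norm_lt_one hr).add
        (summable_pow_mul_geometric_of_norm_lt_one 1 hr)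
    apply Summable.of_nat_of_neg
    · simpa using h0
    · simpa using h0
  have : ∀ d : ℤ, (1 + ENNReal.ofReal |(d:ℝ)|) * (2:ℝ≥0∞) ^ (-(δ * |(d:ℝ)|))
      = ENNReal.ofReal ((1 + |(d:ℝ)|) * (2:ℝ) ^ (-(δ * |(d:ℝ)|))) := by
    intro d
    rw [ENNReal.ofReal_mul (by positivity), ENNReal.ofReal_add (by norm_num) (by positivity),
      aux_two_rpow]; simp
  simp_rw [this]
  exact hs.tsum_ofReal_ne_top

/-- The weight coming from the kernel. -/
noncomputable def auxW (A B : ℝ) (d : ℤ) : ℝ≥0∞ :=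
  (1 + ENNReal.ofReal |(d:ℝ)|) * (2:ℝ≥0∞) ^ (-(max ((d:ℝ) * A) (-(d:ℝ) * B)))

/-- Sequence-space Herz–Morrey norm. -/
noncomputable def auxN (α lam p : ℝ) (F : ℤ → ℝ≥0∞) : ℝ≥0∞ :=
  ⨆ k₀ : ℤ, (2:ℝ≥0∞) ^ (-(k₀:ℝ) * lam) *
    (∑' k : {k : ℤ // k ≤ k₀}, (2:ℝ≥0∞) ^ ((k.1:ℝ) * α * p) * F k.1 ^ p) ^ (1/p)

theorem aux_seq {A B α lam p : ℝ} (hlam : 0 ≤ lam) (hp : 0 < p)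
    (h1 : -B + lam < α) (h2 : α < A) :
    ∃ C : ℝ≥0∞, C ≠ ⊤ ∧ ∀ (K : ℝ≥0∞) (D F : ℤ → ℝ≥0∞),
      (∀ k, D k ≤ K * ∑' j, auxW A B (k - j) * F j) →
      auxN α lam p D ≤ C * K * auxN α lam p F := by
  obtain ⟨δ, hδ, hδ1, hδ2⟩ : ∃ δ : ℝ, 0 < δ ∧ 2 * δ ≤ A - α ∧ 2 * δ ≤ B + α - lam :=
    ⟨min (A - α) (B + α - lam) / 2, by
      have : 0 < min (A - α) (B + α - lam) := lt_min (by linarith) (by linarith)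
      linarith, by linarith [min_le_left (A - α) (B + α - lam)],
      by linarith [min_le_right (A - α) (B + α - lam)]⟩
  set S : ℝ≥0∞ := ∑' d : ℤ, (1 + ENNReal.ofReal |(d:ℝ)|) * (2:ℝ≥0∞) ^ (-(δ * |(d:ℝ)|)) with hS
  set S' : ℝ≥0∞ := ∑' d : ℤ, (2:ℝ≥0∞) ^ (-(δ * p * |(d:ℝ)|)) with hS'
  have hSt : S ≠ ⊤ := aux_summable hδ
  have hSt' : S' ≠ ⊤ := by
    refine ne_top_of_le_ne_top (aux_summable (mul_pos hδ hp)) (ENNReal.tsum_le_tsum fun d => ?_)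
    exact le_mul_of_one_le_left' (by simp)
  refine ⟨S * S' ^ (1/p), ENNReal.mul_ne_top hSt (ENNReal.rpow_ne_top_of_nonneg (by positivity) hSt'), ?_⟩
  intro K D F hD
  set N := auxN α lam p F with hN
  have hp1 : p * (1/p) = 1 := mul_one_div_cancel hp.ne'
  have hp2 : (1/p) * p = 1 := one_div_mul_cancel hp.ne'
  have hF : ∀ k₀ : ℤ, ∑' k : {k : ℤ // k ≤ k₀}, (2:ℝ≥0∞) ^ ((k.1:ℝ) * α * p) * F k.1 ^ p
      ≤ (N * 2 ^ ((k₀:ℝ) * lam)) ^ p := by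
    intro k₀
    have h := le_iSup (fun k₀ : ℤ => (2:ℝ≥0∞) ^ (-(k₀:ℝ) * lam) *
      (∑' k : {k : ℤ // k ≤ k₀}, (2:ℝ≥0∞) ^ ((k.1:ℝ) * α * p) * F k.1 ^ p) ^ (1/p)) k₀
    have h' : (∑' k : {k : ℤ // k ≤ k₀}, (2:ℝ≥0∞) ^ ((k.1:ℝ) * α * p) * F k.1 ^ p) ^ (1/p)
        ≤ N * 2 ^ ((k₀:ℝ) * lam) := by
      calc _ = 2 ^ ((k₀:ℝ) * lam) * ((2:ℝ≥0∞) ^ (-(k₀:ℝ) * lam) *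
            (∑' k : {k : ℤ // k ≤ k₀}, (2:ℝ≥0∞) ^ ((k.1:ℝ) * α * p) * F k.1 ^ p) ^ (1/p)) := by
              rw [← mul_assoc, ← aux_two_add]; simp
        _ ≤ 2 ^ ((k₀:ℝ) * lam) * N := by gcongr; exact h
        _ = _ := mul_comm _ _
    calc _ = ((∑' k : {k : ℤ // k ≤ k₀}, (2:ℝ≥0∞) ^ ((k.1:ℝ) * α * p) * F k.1 ^ p) ^ (1/p)) ^ p := by
          rw [← ENNReal.rpow_mul, hp2, ENNReal.rpow_one]
      _ ≤ _ := by gcongr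
  have hT : ∀ k : ℤ, (2:ℝ≥0∞) ^ ((k:ℝ) * α * p) * D k ^ p ≤
      (K * S) ^ p * ∑' d : ℤ, 2 ^ (-(δ * p * |(d:ℝ)|)) * 2 ^ ((d:ℝ) * lam * p) *
        ((2:ℝ≥0∞) ^ (((k - d : ℤ):ℝ) * α * p) * F (k - d) ^ p) := by
    intro k
    have e1 : (2:ℝ≥0∞) ^ ((k:ℝ) * α) * D k ≤ K * ∑' d : ℤ,
        ((1 + ENNReal.ofReal |(d:ℝ)|) * (2:ℝ≥0∞) ^ (-(δ * |(d:ℝ)|))) *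
        (2 ^ (-(δ * |(d:ℝ)|)) * 2 ^ ((d:ℝ) * lam) * (2 ^ (((k - d : ℤ):ℝ) * α) * F (k - d))) := by
      calc (2:ℝ≥0∞) ^ ((k:ℝ) * α) * D k
          ≤ 2 ^ ((k:ℝ) * α) * (K * ∑' j, auxW A B (k - j) * F j) := by gcongr; exact hD k
        _ = K * (2 ^ ((k:ℝ) * α) * ∑' j, auxW A B (k - j) * F j) := by ring
        _ = K * ∑' j, 2 ^ ((k:ℝ) * α) * (auxW A B (k - j) * F j) := by rw [ENNReal.tsum_mul_left]
        _ = K * ∑' d, 2 ^ ((k:ℝ) * α) * (auxW A B d * F (k - d)) := by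
          congr 1
          rw [← (Equiv.subLeft k).tsum_eq]
          refine tsum_congr fun d => ?_
          simp
        _ ≤ _ := by
          refine mul_le_mul' le_rfl (ENNReal.tsum_le_tsum fun d => ?_)
          unfold auxW
          have : (2:ℝ≥0∞) ^ ((k:ℝ) * α) * (2:ℝ≥0∞) ^ (-(max ((d:ℝ) * A) (-(d:ℝ) * B))) ≤
              (2:ℝ≥0∞) ^ (-(δ * |(d:ℝ)|)) * (2 ^ (-(δ * |(d:ℝ)|)) * 2 ^ ((d:ℝ) * lam)
               * 2 ^ (((k - d : ℤ):ℝ) * α)) := by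
            simp only [← aux_two_add]
            apply ENNReal.rpow_le_rpow_of_exponent_le (by norm_num)
            push_cast
            rcases le_total 0 (d:ℝ) with hd | hd
            · rw [abs_of_nonneg hd]
              have := le_max_left ((d:ℝ) * A) (-(d:ℝ) * B)
              nlinarith [mul_le_mul_of_nonneg_left hδ1 hd, mul_nonneg hd hlam]
            · rw [abs_of_nonpos hd]
              have := le_max_right ((d:ℝ) * A) (-(d:ℝ) * B)
              nlinarith [mul_le_mul_of_nonneg_left hδ2 (neg_nonneg.2 hd)]
          calc _ = (1 + ENNReal.ofReal |(d:ℝ)|) * ((2:ℝ≥0∞) ^ ((k:ℝ) * α) *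
                (2:ℝ≥0∞) ^ (-(max ((d:ℝ) * A) (-(d:ℝ) * B)))) * F (k - d) := by ring
            _ ≤ (1 + ENNReal.ofReal |(d:ℝ)|) * ((2:ℝ≥0∞) ^ (-(δ * |(d:ℝ)|)) *
              (2 ^ (-(δ * |(d:ℝ)|)) * 2 ^ ((d:ℝ) * lam)
               * 2 ^ (((k - d : ℤ):ℝ) * α))) * F (k - d) := by gcongr
            _ = _ := by ring
    calc (2:ℝ≥0∞) ^ ((k:ℝ) * α * p) * D k ^ p = ((2:ℝ≥0∞) ^ ((k:ℝ) * α) * D k) ^ p := by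
          rw [ENNReal.mul_rpow_of_nonneg _ _ hp.le, ← ENNReal.rpow_mul]
      _ ≤ _ := ENNReal.rpow_le_rpow e1 hp.le
      _ ≤ K ^ p * (S ^ p * ∑' d : ℤ, (2 ^ (-(δ * |(d:ℝ)|)) * 2 ^ ((d:ℝ) * lam) *
            (2 ^ (((k - d : ℤ):ℝ) * α) * F (k - d))) ^ p) := by
          rw [ENNReal.mul_rpow_of_nonneg _ _ hp.le]
          gcongr
          exact aux_sup_trick _ _ hp
      _ = _ := by
          rw [ENNReal.mul_rpow_of_nonneg _ _ hp.le, mul_assoc]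
          congr 2
          refine tsum_congr fun d => ?_
          simp only [ENNReal.mul_rpow_of_nonneg _ _ hp.le, ← ENNReal.rpow_mul]
          congr 3
          ring
  refine iSup_le fun k₀ => ?_
  have key : ∑' k : {k : ℤ // k ≤ k₀}, (2:ℝ≥0∞) ^ ((k.1:ℝ) * α * p) * D k.1 ^ p
      ≤ (K * S * S' ^ (1/p) * (N * 2 ^ ((k₀:ℝ) * lam))) ^ p := by
    calc _ ≤ ∑' k : {k : ℤ // k ≤ k₀}, (K * S) ^ p * ∑' d : ℤ, 2 ^ (-(δ * p * |(d:ℝ)|)) * 2 ^ ((d:ℝ) * lam * p) *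
        ((2:ℝ≥0∞) ^ (((k.1 - d : ℤ):ℝ) * α * p) * F (k.1 - d) ^ p) :=
          ENNReal.tsum_le_tsum fun k => hT k.1
      _ = (K * S) ^ p * ∑' d : ℤ, 2 ^ (-(δ * p * |(d:ℝ)|)) * 2 ^ ((d:ℝ) * lam * p) *
        ∑' k : {k : ℤ // k ≤ k₀}, ((2:ℝ≥0∞) ^ (((k.1 - d : ℤ):ℝ) * α * p) * F (k.1 - d) ^ p) := by
          rw [ENNReal.tsum_mul_left, ENNReal.tsum_comm]
          simp_rw [ENNReal.tsum_mul_left]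
      _ ≤ (K * S) ^ p * ∑' d : ℤ, 2 ^ (-(δ * p * |(d:ℝ)|)) * (N * 2 ^ ((k₀:ℝ) * lam)) ^ p := by
          refine mul_le_mul' le_rfl (ENNReal.tsum_le_tsum fun d => ?_)
          have e : ∑' k : {k : ℤ // k ≤ k₀}, ((2:ℝ≥0∞) ^ (((k.1 - d : ℤ):ℝ) * α * p) * F (k.1 - d) ^ p)
             = ∑' k : {k : ℤ // k ≤ k₀ - d}, ((2:ℝ≥0∞) ^ ((k.1:ℝ) * α * p) * F k.1 ^ p) := by
            let eqv : {k : ℤ // k ≤ k₀} ≃ {k : ℤ // k ≤ k₀ - d} :=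
              (Equiv.subRight d).subtypeEquiv (fun a => by simp)
            rw [← eqv.tsum_eq]
            rfl
          rw [e]
          calc _ ≤ 2 ^ (-(δ * p * |(d:ℝ)|)) * 2 ^ ((d:ℝ) * lam * p) * (N * 2 ^ (((k₀ - d : ℤ):ℝ) * lam)) ^ p := by
                gcongr; exact hF _
            _ = _ := by
              rw [mul_assoc]
              congr 1
              rw [ENNReal.mul_rpow_of_nonneg _ _ hp.le, ENNReal.mul_rpow_of_nonneg _ _ hp.le,
                mul_left_comm, ← ENNReal.rpow_mul, ← ENNReal.rpow_mul, ← aux_two_add]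
              congr 2
              push_cast; ring
      _ = _ := by
          rw [ENNReal.tsum_mul_right, ← hS', ENNReal.mul_rpow_of_nonneg (K * S * S' ^ (1/p)) _ hp.le,
            ENNReal.mul_rpow_of_nonneg (K * S) _ hp.le, ← ENNReal.rpow_mul S', hp2, ENNReal.rpow_one]
          ring
  calc _ ≤ (2:ℝ≥0∞) ^ (-(k₀:ℝ) * lam) * ((K * S * S' ^ (1/p) * (N * 2 ^ ((k₀:ℝ) * lam))) ^ p) ^ (1/p) := by
        gcongr
    _ = (2:ℝ≥0∞) ^ (-(k₀:ℝ) * lam) * 2 ^ ((k₀:ℝ) * lam) * (S * S' ^ (1/p) * K * N) := by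
        rw [← ENNReal.rpow_mul, hp1, ENNReal.rpow_one]; ring
    _ = _ := by rw [← aux_two_add]; simp

theorem aux_vol {n : ℕ} (x : EuclideanSpace ℝ (Fin n)) {r : ℝ} (hr : 0 < r) :
    volume (Metric.ball x r) = ENNReal.ofReal (r ^ n) *
      volume (Metric.ball (0 : EuclideanSpace ℝ (Fin n)) 1) := by
  have := Measure.addHaar_ball_of_pos (volume : Measure (EuclideanSpace ℝ (Fin n))) x hr
  simpa using this

theorem aux_vol_closed {n : ℕ} (x : EuclideanSpace ℝ (Fin n)) {r : ℝ} (hr : 0 < r) :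
    volume (Metric.closedBall x r) = volume (Metric.ball x r) := by
  rw [aux_vol x hr]
  have := Measure.addHaar_closedBall (volume : Measure (EuclideanSpace ℝ (Fin n))) x hr.le
  simpa using this

theorem aux_vol_ne_zero {n : ℕ} (x : EuclideanSpace ℝ (Fin n)) {r : ℝ} (hr : 0 < r) :
    volume (Metric.ball x r) ≠ 0 := (Metric.measure_ball_pos _ _ hr).ne'

theorem aux_vol_ne_top {n : ℕ} (x : EuclideanSpace ℝ (Fin n)) (r : ℝ) :
    volume (Metric.ball x r) ≠ ⊤ := measure_ball_lt_top.ne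

theorem aux_HL {n : ℕ} (h : EuclideanSpace ℝ (Fin n) → ℝ≥0∞) (hh : ∫⁻ y, h y ≠ ⊤) :
    ∀ᵐ x, (⨆ r : {r : ℝ // 0 < r}, (volume (Metric.ball x r.1))⁻¹ *
      ∫⁻ y in Metric.ball x r.1, h y) < ⊤ := by
  set ρ := (volume : Measure (EuclideanSpace ℝ (Fin n))).withDensity h with hρ
  have : IsFiniteMeasure ρ := isFiniteMeasure_withDensity hh
  filter_upwards [Besicovitch.ae_tendsto_rnDeriv ρ volume, Measure.rnDeriv_lt_top ρ volume]
    with x hx hx2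
  have h1 : ∀ᶠ r in nhdsWithin (0:ℝ) (Set.Ioi 0),
      ρ (Metric.closedBall x r) / volume (Metric.closedBall x r) < ρ.rnDeriv volume x + 1 :=
    hx.eventually (gt_mem_nhds (ENNReal.lt_add_right hx2.ne one_ne_zero))
  obtain ⟨ε, hε, hε2⟩ := mem_nhdsGT_iff_exists_Ioo_subset.1 h1
  have hε0 : (0:ℝ) < ε := hε
  refine lt_of_le_of_lt (b := max (ρ.rnDeriv volume x + 1)
    ((volume (Metric.ball x ε))⁻¹ * ∫⁻ y, h y)) (iSup_le ?_) ?_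
  · rintro ⟨r, hr⟩
    rcases lt_or_ge r ε with h | h
    · refine le_max_of_le_left ?_
      have := hε2 (show r ∈ Set.Ioo 0 ε from ⟨hr, h⟩)
      refine le_trans ?_ (le_of_lt this)
      rw [aux_vol_closed x hr, ENNReal.div_eq_inv_mul, hρ, withDensity_apply _ measurableSet_closedBall]
      gcongr
      exact Metric.ball_subset_closedBall
    · refine le_max_of_le_right ?_
      dsimp only
      gcongr
      exact Measure.restrict_le_self
  · refine max_lt (ENNReal.add_lt_top.2 ⟨hx2, ENNReal.one_lt_top⟩)
      (ENNReal.mul_lt_top (ENNReal.inv_lt_top.2 (Metric.measure_ball_pos _ _ hε0)) hh.lt_top)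

/-- `[0,∞]`-valued maximal commutator. -/
noncomputable def auxE (n : ℕ) (b g : EuclideanSpace ℝ (Fin n) → ℝ)
    (x : EuclideanSpace ℝ (Fin n)) : ℝ≥0∞ :=
  ⨆ r : {r : ℝ // 0 < r}, (volume (Metric.ball x r.1))⁻¹ *
    ∫⁻ y in Metric.ball x r.1, ‖b x - b y‖ₑ * ‖g y‖ₑ

theorem auxE_finite {n : ℕ} {b g : EuclideanSpace ℝ (Fin n) → ℝ}
    (hg : Measurable g) (c : ℝ)
    (h1 : ∫⁻ y, ‖g y‖ₑ ≠ ⊤) (h2 : ∫⁻ y, ‖b y - c‖ₑ * ‖g y‖ₑ ≠ ⊤) :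
    ∀ᵐ x, auxE n b g x < ⊤ := by
  filter_upwards [aux_HL _ h1, aux_HL _ h2] with x hx1 hx2
  refine lt_of_le_of_lt (b := ‖b x - c‖ₑ * (⨆ r : {r : ℝ // 0 < r}, (volume (Metric.ball x r.1))⁻¹ *
      ∫⁻ y in Metric.ball x r.1, ‖g y‖ₑ) + (⨆ r : {r : ℝ // 0 < r}, (volume (Metric.ball x r.1))⁻¹ *
      ∫⁻ y in Metric.ball x r.1, ‖b y - c‖ₑ * ‖g y‖ₑ)) (iSup_le fun r => ?_)
      (ENNReal.add_lt_top.2 ⟨ENNReal.mul_lt_top (by simp) hx1, hx2⟩)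
  calc (volume (Metric.ball x r.1))⁻¹ * ∫⁻ y in Metric.ball x r.1, ‖b x - b y‖ₑ * ‖g y‖ₑ
      ≤ (volume (Metric.ball x r.1))⁻¹ * ∫⁻ y in Metric.ball x r.1,
          (‖b x - c‖ₑ * ‖g y‖ₑ + ‖b y - c‖ₑ * ‖g y‖ₑ) := by
        gcongr with y
        rw [← add_mul]
        gcongr
        have : b x - b y = (b x - c) - (b y - c) := by ring
        rw [this]
        exact enorm_sub_le
    _ = ‖b x - c‖ₑ * ((volume (Metric.ball x r.1))⁻¹ * ∫⁻ y in Metric.ball x r.1, ‖g y‖ₑ) +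
        (volume (Metric.ball x r.1))⁻¹ * ∫⁻ y in Metric.ball x r.1, ‖b y - c‖ₑ * ‖g y‖ₑ := by
        rw [lintegral_add_left (by fun_prop), lintegral_const_mul _ (by fun_prop)]
        ring
    _ ≤ _ := by
        gcongr
        · exact le_iSup (fun r : {r : ℝ // 0 < r} => (volume (Metric.ball x r.1))⁻¹ *
            ∫⁻ y in Metric.ball x r.1, ‖g y‖ₑ) r
        · exact le_iSup (fun r : {r : ℝ // 0 < r} => (volume (Metric.ball x r.1))⁻¹ *
            ∫⁻ y in Metric.ball x r.1, ‖b y - c‖ₑ * ‖g y‖ₑ) r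

theorem auxE_le_maxComm {n : ℕ} {b g : EuclideanSpace ℝ (Fin n) → ℝ}
    (hb : Measurable b) (hg : Measurable g) {x : EuclideanSpace ℝ (Fin n)}
    (hx : auxE n b g x < ⊤) : auxE n b g x ≤ ‖maxComm n b g x‖ₑ := by
  have hterm : ∀ r : {r : ℝ // 0 < r},
      ENNReal.ofReal (((volume (Metric.ball x r.1)).toReal)⁻¹ *
        ∫ y in Metric.ball x r.1, |b x - b y| * |g y|) =
      (volume (Metric.ball x r.1))⁻¹ *
        ∫⁻ y in Metric.ball x r.1, ‖b x - b y‖ₑ * ‖g y‖ₑ := by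
    intro r
    have hr := aux_vol_ne_zero x r.2
    have hr' := aux_vol_ne_top x r.1
    have hfin : ∫⁻ y in Metric.ball x r.1, ‖b x - b y‖ₑ * ‖g y‖ₑ < ⊤ := by
      have := lt_of_le_of_lt (le_iSup (fun r : {r : ℝ // 0 < r} => (volume (Metric.ball x r.1))⁻¹ *
        ∫⁻ y in Metric.ball x r.1, ‖b x - b y‖ₑ * ‖g y‖ₑ) r) hx
      by_contra hcon
      rw [not_lt_top_iff] at hcon
      simp only [hcon] at this
      rw [ENNReal.mul_top (ENNReal.inv_ne_zero.2 hr')] at this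
      exact lt_irrefl _ this
    rw [ENNReal.ofReal_mul (by positivity), ENNReal.ofReal_inv_of_pos
      (ENNReal.toReal_pos hr hr'), ENNReal.ofReal_toReal hr']
    congr 1
    have e : ∀ y, ‖b x - b y‖ₑ * ‖g y‖ₑ = ENNReal.ofReal (|b x - b y| * |g y|) := by
      intro y
      rw [ENNReal.ofReal_mul (abs_nonneg _)]
      simp [Real.enorm_eq_ofReal_abs]
    simp only [e]
    rw [ofReal_integral_eq_lintegral_ofReal]
    · refine ⟨by fun_prop, ?_⟩
      rw [hasFiniteIntegral_iff_ofReal (Filter.Eventually.of_forall fun y => by positivity)]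
      simpa only [e] using hfin
    · exact Filter.Eventually.of_forall fun y => by positivity
  have hbdd : BddAbove (Set.range fun r : {r : ℝ // 0 < r} => ((volume (Metric.ball x r.1)).toReal)⁻¹ *
        ∫ y in Metric.ball x r.1, |b x - b y| * |g y|) := by
    refine ⟨(auxE n b g x).toReal, ?_⟩
    rintro _ ⟨r, rfl⟩
    dsimp only
    rw [← ENNReal.ofReal_le_iff_le_toReal hx.ne, hterm]
    exact le_iSup (fun r : {r : ℝ // 0 < r} => (volume (Metric.ball x r.1))⁻¹ *
        ∫⁻ y in Metric.ball x r.1, ‖b x - b y‖ₑ * ‖g y‖ₑ) r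
  refine iSup_le fun r => ?_
  rw [← hterm, Real.enorm_eq_ofReal_abs]
  apply ENNReal.ofReal_le_ofReal
  exact (le_ciSup hbdd r).trans (le_abs_self _)

theorem aux_eLp {n : ℕ} {q : ℝ} (hq : 1 < q) (g : EuclideanSpace ℝ (Fin n) → ℝ) :
    eLpNorm g (ENNReal.ofReal q) volume = (∫⁻ y, ‖g y‖ₑ ^ q) ^ (1/q) := by
  rw [eLpNorm_eq_lintegral_rpow_enorm_toReal (by simp; linarith) (by simp),
    ENNReal.toReal_ofReal (by linarith)]

/-- `L^q` bound of the `[0,∞]`-valued operator. -/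
theorem auxE_Lq {n : ℕ} {q : ℝ} (hq : 1 < q) {b g : EuclideanSpace ℝ (Fin n) → ℝ} {K : ℝ≥0∞}
    (hb : Measurable b) (hg : Measurable g) 
    (hLq : ∀ f, eLpNorm (maxComm n b f) (ENNReal.ofReal q) volume ≤
      K * eLpNorm f (ENNReal.ofReal q) volume)
    (hfin : ∀ᵐ x, auxE n b g x < ⊤) :
    (∫⁻ x, auxE n b g x ^ q) ^ (1/q) ≤ K * (∫⁻ y, ‖g y‖ₑ ^ q) ^ (1/q) := by
  have := hLq g
  rw [aux_eLp hq, aux_eLp hq] at this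
  refine le_trans ?_ this
  gcongr ?_ ^ _
  apply lintegral_mono_ae
  filter_upwards [hfin] with x hx
  gcongr
  exact auxE_le_maxComm hb hg hx

theorem aux_ball_lower {n : ℕ} {b g : EuclideanSpace ℝ (Fin n) → ℝ} {R : ℝ} (hR : 0 < R)
    {x : EuclideanSpace ℝ (Fin n)} (hx : x ∈ Metric.ball 0 R) :
    (2 ^ n * volume (Metric.ball (0 : EuclideanSpace ℝ (Fin n)) R))⁻¹ *
      ∫⁻ y in Metric.ball 0 R, ‖b x - b y‖ₑ * ‖g y‖ₑ ≤ auxE n b g x := by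
  refine le_trans ?_ (le_iSup (fun r : {r : ℝ // 0 < r} => (volume (Metric.ball x r.1))⁻¹ *
        ∫⁻ y in Metric.ball x r.1, ‖b x - b y‖ₑ * ‖g y‖ₑ) ⟨2 * R, by positivity⟩)
  dsimp only
  rw [aux_vol x (by positivity : 0 < 2 * R), aux_vol 0 hR, mul_pow, ENNReal.ofReal_mul (by positivity),
    ENNReal.ofReal_pow (by norm_num : (0:ℝ) ≤ 2), mul_assoc]
  simp only [ENNReal.ofReal_ofNat]
  gcongr
  apply Metric.ball_subset_ball'
  rw [Metric.mem_ball] at hx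
  rw [dist_comm]; linarith

/-- mean value vs. average oscillation -/
theorem aux_mean {n : ℕ} {b : EuclideanSpace ℝ (Fin n) → ℝ} (hb : LocallyIntegrable b volume)
    {R : ℝ} (hR : 0 < R) (t : ℝ) :
    ‖t - ⨍ z in Metric.ball (0 : EuclideanSpace ℝ (Fin n)) R, b z‖ₑ ≤
      (volume (Metric.ball (0 : EuclideanSpace ℝ (Fin n)) R))⁻¹ *
      ∫⁻ y in Metric.ball 0 R, ‖t - b y‖ₑ := by
  set B := Metric.ball (0 : EuclideanSpace ℝ (Fin n)) R
  have h0 : volume B ≠ 0 := aux_vol_ne_zero _ hR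
  have h1 : volume B ≠ ⊤ := aux_vol_ne_top _ _
  have hi : IntegrableOn b B volume :=
    (hb.integrableOn_isCompact (isCompact_closedBall 0 R)).mono_set Metric.ball_subset_closedBall
  have : IsFiniteMeasure (volume.restrict B) := ⟨by simpa using h1.lt_top⟩
  have : t - ⨍ z in B, b z = (volume B).toReal⁻¹ * ∫ z in B, (t - b z) := by
    rw [integral_sub (integrable_const _) hi, setAverage_eq, setIntegral_const]
    simp only [Measure.real, smul_eq_mul]
    have : (volume B).toReal ≠ 0 := (ENNReal.toReal_pos h0 h1).ne'
    field_simp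
  rw [this, enorm_mul]
  gcongr
  · rw [Real.enorm_of_nonneg (by positivity), ENNReal.ofReal_inv_of_pos
      (ENNReal.toReal_pos h0 h1), ENNReal.ofReal_toReal h1]
  · exact enorm_integral_le_lintegral_enorm _

theorem aux_holder {n : ℕ} {q : ℝ} (hq : 1 < q) (A : Set (EuclideanSpace ℝ (Fin n)))
    {F : EuclideanSpace ℝ (Fin n) → ℝ≥0∞} (hF : Measurable F) :
    ∫⁻ y in A, F y ≤ volume A ^ (1 - 1/q) * (∫⁻ y in A, F y ^ q) ^ (1/q) := by
  have hc : q.HolderConjugate (1 - 1/q)⁻¹ := by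
    rw [Real.holderConjugate_iff]
    refine ⟨hq, ?_⟩
    rw [inv_inv]; ring
  have := ENNReal.lintegral_mul_le_Lp_mul_Lq (volume.restrict A) hc hF.aemeasurable
    (aemeasurable_const (b := (1:ℝ≥0∞)))
  simp only [Pi.mul_apply, mul_one, ENNReal.one_rpow, lintegral_one, Measure.restrict_apply_univ] at this
  rw [mul_comm]
  simpa using this

theorem aux_osc {n : ℕ} {q : ℝ} (hq : 1 < q) {b : EuclideanSpace ℝ (Fin n) → ℝ} {K : ℝ≥0∞}
    (hb : Measurable b) (hbl : LocallyIntegrable b volume)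
    (hLq : ∀ f, eLpNorm (maxComm n b f) (ENNReal.ofReal q) volume ≤
      K * eLpNorm f (ENNReal.ofReal q) volume) {R : ℝ} (hR : 0 < R) :
    (∫⁻ x in Metric.ball 0 R, ‖b x - ⨍ z in Metric.ball (0 : EuclideanSpace ℝ (Fin n)) R, b z‖ₑ ^ q)
      ^ (1/q) ≤ 2 ^ n * K * volume (Metric.ball (0 : EuclideanSpace ℝ (Fin n)) R) ^ (1/q) := by
  have hq0 : 0 < q := by linarith
  set B := Metric.ball (0 : EuclideanSpace ℝ (Fin n)) R with hB
  have hBm : MeasurableSet B := measurableSet_ball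
  have h0 : volume B ≠ 0 := aux_vol_ne_zero _ hR
  have h1 : volume B ≠ ⊤ := aux_vol_ne_top _ _
  have hi : IntegrableOn b B volume :=
    (hbl.integrableOn_isCompact (isCompact_closedBall 0 R)).mono_set Metric.ball_subset_closedBall
  set g : EuclideanSpace ℝ (Fin n) → ℝ := B.indicator 1 with hg
  have hgm : Measurable g := measurable_one.indicator hBm
  have hge : ∀ y, ‖g y‖ₑ = B.indicator 1 y := by
    intro y; by_cases hy : y ∈ B <;> simp [hg, hy]
  have hfin : ∀ᵐ x, auxE n b g x < ⊤ := by
    apply auxE_finite hgm 0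
    · simp only [hge]
      rw [lintegral_indicator_one hBm]; exact h1
    · have : (fun y => ‖b y - 0‖ₑ * ‖g y‖ₑ) = B.indicator (fun y => ‖b y‖ₑ) := by
        funext y; by_cases hy : y ∈ B <;> simp [hge, hy]
      rw [this, lintegral_indicator hBm]
      exact hi.2.ne
  have hE := auxE_Lq hq hb hgm hLq hfin
  have hgq : ∫⁻ y, ‖g y‖ₑ ^ q = volume B := by
    have : (fun y => ‖g y‖ₑ ^ q) = B.indicator 1 := by
      funext y; by_cases hy : y ∈ B <;> simp [hge, hy, hq0]
    rw [this, lintegral_indicator_one hBm]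
  rw [hgq] at hE
  calc _ ≤ (∫⁻ x in B, (2 ^ n * auxE n b g x) ^ q) ^ (1/q) := by
        gcongr ?_ ^ _
        apply setLIntegral_mono' hBm
        intro x hx
        gcongr
        refine (aux_mean hbl hR (b x)).trans ?_
        refine le_trans ?_ (mul_le_mul' le_rfl (aux_ball_lower (b := b) (g := g) hR hx))
        rw [← mul_assoc, ENNReal.mul_inv (by simp) (by simp), ← mul_assoc,
          ENNReal.mul_inv_cancel (by simp) (by simp), one_mul]
        refine mul_le_mul' le_rfl ?_
        apply setLIntegral_mono' hBm
        intro y hy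
        have : y ∈ B := hy
        simp [hge, this]
    _ = 2 ^ n * (∫⁻ x in B, (auxE n b g x) ^ q) ^ (1/q) := by
        simp only [ENNReal.mul_rpow_of_nonneg _ _ hq0.le]
        rw [lintegral_const_mul' _ _ (by simp), ENNReal.mul_rpow_of_nonneg _ _ (by positivity),
          ← ENNReal.rpow_mul, mul_one_div_cancel hq0.ne', ENNReal.rpow_one]
    _ ≤ 2 ^ n * (∫⁻ x, (auxE n b g x) ^ q) ^ (1/q) := by
        gcongr; exact Measure.restrict_le_self
    _ ≤ _ := by rw [mul_assoc]; gcongr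

theorem aux_dual_bdd {n : ℕ} {q : ℝ} (hq : 1 < q) {b g : EuclideanSpace ℝ (Fin n) → ℝ} {K : ℝ≥0∞}
    (hb : Measurable b) (hbl : LocallyIntegrable b volume) (hg : Measurable g)
    (hLq : ∀ f, eLpNorm (maxComm n b f) (ENNReal.ofReal q) volume ≤
      K * eLpNorm f (ENNReal.ofReal q) volume) {R : ℝ} (hR : 0 < R)
    (N : ℝ≥0∞) (hN : N ≠ ⊤) (hgN : ∀ y, ‖g y‖ₑ ≤ (Metric.ball 0 R).indicator (fun _ => N) y) :
    ∫⁻ y in Metric.ball 0 R, ‖b y - ⨍ z in Metric.ball (0 : EuclideanSpace ℝ (Fin n)) R, b z‖ₑ * ‖g y‖ₑ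
      ≤ 2 ^ n * K * volume (Metric.ball (0 : EuclideanSpace ℝ (Fin n)) R) ^ (1 - 1/q) *
        (∫⁻ y, ‖g y‖ₑ ^ q) ^ (1/q) := by
  have hq0 : 0 < q := by linarith
  set B := Metric.ball (0 : EuclideanSpace ℝ (Fin n)) R with hB
  have hBm : MeasurableSet B := measurableSet_ball
  have h0 : volume B ≠ 0 := aux_vol_ne_zero _ hR
  have h1 : volume B ≠ ⊤ := aux_vol_ne_top _ _
  have hi : IntegrableOn b B volume :=
    (hbl.integrableOn_isCompact (isCompact_closedBall 0 R)).mono_set Metric.ball_subset_closedBall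
  have hfin : ∀ᵐ x, auxE n b g x < ⊤ := by
    apply auxE_finite hg 0
    · refine ne_top_of_le_ne_top ?_ (lintegral_mono hgN)
      rw [lintegral_indicator_const hBm]; exact ENNReal.mul_ne_top hN h1
    · refine ne_top_of_le_ne_top (b := ∫⁻ y, B.indicator (fun y => N * ‖b y‖ₑ) y) ?_
        (lintegral_mono fun y => ?_)
      · rw [lintegral_indicator hBm, lintegral_const_mul _ (by fun_prop)]
        exact ENNReal.mul_ne_top hN hi.2.ne
      · have := hgN y
        by_cases hy : y ∈ B
        · simp only [hy, Set.indicator_of_mem, sub_zero] at this ⊢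
          rw [mul_comm]; gcongr
        · simp only [hy, not_false_eq_true, Set.indicator_of_notMem, sub_zero] at this ⊢
          simp at this; simp [this]
  have hE := auxE_Lq hq hb hg hLq hfin
  set H : EuclideanSpace ℝ (Fin n) → ℝ≥0∞ := fun x => (2 ^ n * volume B)⁻¹ *
      ∫⁻ y in B, ‖b x - b y‖ₑ * ‖g y‖ₑ with hH
  have hHm : Measurable H := by
    apply Measurable.const_mul
    apply Measurable.lintegral_prod_right'
      (f := fun z : EuclideanSpace ℝ (Fin n) × EuclideanSpace ℝ (Fin n) => ‖b z.1 - b z.2‖ₑ * ‖g z.2‖ₑ)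
    fun_prop
  have hHint : ∫⁻ x in B, H x ≤ volume B ^ (1 - 1/q) * (K * (∫⁻ y, ‖g y‖ₑ ^ q) ^ (1/q)) := by
    refine (aux_holder hq B hHm).trans ?_
    gcongr
    refine le_trans ?_ hE
    gcongr ?_ ^ _
    refine le_trans ?_ (setLIntegral_le_lintegral B _)
    apply setLIntegral_mono' hBm
    intro x hx
    gcongr
    exact aux_ball_lower hR hx
  have hlow : ∫⁻ y in B, ‖b y - ⨍ z in B, b z‖ₑ * ‖g y‖ₑ ≤ 2 ^ n * ∫⁻ x in B, H x := by
    rw [hH, lintegral_const_mul _ (by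
      apply Measurable.lintegral_prod_right'
        (f := fun z : EuclideanSpace ℝ (Fin n) × EuclideanSpace ℝ (Fin n) => ‖b z.1 - b z.2‖ₑ * ‖g z.2‖ₑ)
      fun_prop)]
    rw [lintegral_lintegral_swap (by fun_prop)]
    rw [← mul_assoc, ENNReal.mul_inv (by simp) (by simp), ← mul_assoc,
          ENNReal.mul_inv_cancel (by simp) (by simp), one_mul]
    rw [← lintegral_const_mul' _ _ (ENNReal.inv_ne_top.2 h0)]
    apply lintegral_mono
    intro y
    dsimp only
    rw [lintegral_mul_const _ (by fun_prop), ← mul_assoc]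
    gcongr
    refine (aux_mean hbl hR (b y)).trans (le_of_eq ?_)
    congr 1
    apply lintegral_congr
    intro x
    exact enorm_sub_rev _ _
  calc _ ≤ _ := hlow
    _ ≤ 2 ^ n * (volume B ^ (1 - 1/q) * (K * (∫⁻ y, ‖g y‖ₑ ^ q) ^ (1/q))) := by gcongr
    _ = _ := by ring

theorem aux_dual {n : ℕ} {q : ℝ} (hq : 1 < q) {b g : EuclideanSpace ℝ (Fin n) → ℝ} {K : ℝ≥0∞}
    (hb : Measurable b) (hbl : LocallyIntegrable b volume) (hg : Measurable g)
    (hLq : ∀ f, eLpNorm (maxComm n b f) (ENNReal.ofReal q) volume ≤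
      K * eLpNorm f (ENNReal.ofReal q) volume) {R : ℝ} (hR : 0 < R)
    {A : Set (EuclideanSpace ℝ (Fin n))} (hA : MeasurableSet A) (hAB : A ⊆ Metric.ball 0 R) :
    ∫⁻ y in A, ‖b y - ⨍ z in Metric.ball (0 : EuclideanSpace ℝ (Fin n)) R, b z‖ₑ * ‖g y‖ₑ
      ≤ 2 ^ n * K * volume (Metric.ball (0 : EuclideanSpace ℝ (Fin n)) R) ^ (1 - 1/q) *
        (∫⁻ y in A, ‖g y‖ₑ ^ q) ^ (1/q) := by
  have hq0 : 0 < q := by linarith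
  set B := Metric.ball (0 : EuclideanSpace ℝ (Fin n)) R with hB
  set c := ⨍ z in B, b z
  set G : ℕ → EuclideanSpace ℝ (Fin n) → ℝ := fun N => A.indicator (fun y => min |g y| N) with hG
  have hGm : ∀ N, Measurable (G N) := fun N => by
    apply Measurable.indicator _ hA
    fun_prop
  have hGe : ∀ N y, ‖G N y‖ₑ = A.indicator (fun y => min ‖g y‖ₑ N) y := by
    intro N y
    by_cases hy : y ∈ A
    · simp only [hG, hy, Set.indicator_of_mem]
      rw [Real.enorm_of_nonneg (by positivity), ENNReal.ofReal_min]
      simp [Real.enorm_eq_ofReal_abs]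
    · simp [hG, hy]
  have hle : ∀ N : ℕ, ∫⁻ y in A, ‖b y - c‖ₑ * min ‖g y‖ₑ N ≤ 2 ^ n * K * volume B ^ (1 - 1/q) *
        (∫⁻ y in A, ‖g y‖ₑ ^ q) ^ (1/q) := by
    intro N
    calc ∫⁻ y in A, ‖b y - c‖ₑ * min ‖g y‖ₑ N = ∫⁻ y in A, ‖b y - c‖ₑ * ‖G N y‖ₑ := by
          apply setLIntegral_congr_fun hA
          intro y hy
          simp [hGe, hy]
      _ ≤ ∫⁻ y in B, ‖b y - c‖ₑ * ‖G N y‖ₑ := lintegral_mono_set hAB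
      _ ≤ 2 ^ n * K * volume B ^ (1 - 1/q) * (∫⁻ y, ‖G N y‖ₑ ^ q) ^ (1/q) := by
          refine aux_dual_bdd hq hb hbl (hGm N) hLq hR N (by simp) ?_
          intro y
          rw [hGe]
          by_cases hy : y ∈ A
          · simp [hy, hAB hy, ← hB]
          · simp [hy]
      _ ≤ _ := by
          refine mul_le_mul' le_rfl (ENNReal.rpow_le_rpow ?_ (by positivity))
          rw [← lintegral_indicator hA]
          apply lintegral_mono
          intro y
          dsimp only
          rw [hGe]
          by_cases hy : y ∈ A
          · simp only [hy, Set.indicator_of_mem]; gcongr; exact min_le_left _ _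
          · simp [hy, hq0]
  have hlim := lintegral_tendsto_of_tendsto_of_monotone (μ := volume.restrict A)
    (f := fun (N : ℕ) y => ‖b y - c‖ₑ * min ‖g y‖ₑ N) (F := fun y => ‖b y - c‖ₑ * ‖g y‖ₑ)
    (fun N => by fun_prop)
    (Filter.Eventually.of_forall fun y N N' h => by dsimp only; gcongr)
    (Filter.Eventually.of_forall fun y => by
      obtain ⟨N, hN⟩ := ENNReal.exists_nat_gt (r := ‖g y‖ₑ) (by simp)
      apply tendsto_const_nhds.congr'
      filter_upwards [Filter.eventually_ge_atTop N] with m hm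
      rw [min_eq_left]
      exact hN.le.trans (by exact_mod_cast hm))
  exact le_of_tendsto' hlim hle

theorem aux_vol2 {n : ℕ} (x : EuclideanSpace ℝ (Fin n)) (m : ℤ) :
    volume (Metric.ball x ((2:ℝ) ^ m)) = 2 ^ ((m:ℝ) * n) *
      volume (Metric.ball (0 : EuclideanSpace ℝ (Fin n)) 1) := by
  rw [aux_vol x (by positivity), aux_two_rpow, Real.rpow_mul (by norm_num), Real.rpow_intCast,
    Real.rpow_natCast]

theorem aux_annulus_meas (n : ℕ) (k : ℤ) : MeasurableSet (annulus n k) := by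
  unfold annulus
  exact (measurableSet_lt measurable_const measurable_norm).inter
    (measurableSet_le measurable_norm measurable_const)

theorem aux_annulus_sub {n : ℕ} {k m : ℤ} (h : k < m) : annulus n k ⊆ Metric.ball 0 ((2:ℝ) ^ m) := by
  intro x hx
  rw [mem_ball_zero_iff]
  exact hx.2.trans_lt (zpow_lt_zpow_right₀ (by norm_num) h)

theorem aux_annulus_disj {n : ℕ} {k m : ℤ} (h : k < m) {x : EuclideanSpace ℝ (Fin n)}
    (h1 : x ∈ annulus n k) : x ∉ annulus n m := by
  intro h2
  have := zpow_le_zpow_right₀ (by norm_num : (1:ℝ) ≤ 2) (show k ≤ m - 1 by omega)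
  linarith [h1.2, h2.1]

theorem aux_annulus_cover {n : ℕ} {x : EuclideanSpace ℝ (Fin n)} (hx : x ≠ 0) :
    ∃ k, x ∈ annulus n k := by
  obtain ⟨k, h1, h2⟩ := exists_mem_Ioc_zpow (norm_pos_iff.2 hx) (by norm_num : (1:ℝ) < 2)
  exact ⟨k + 1, by simpa using h1, h2⟩

theorem aux_far {n : ℕ} {j k : ℤ} (hjk : 2 ≤ |j - k|) {x : EuclideanSpace ℝ (Fin n)}
    (hx : x ∈ annulus n k) {r : ℝ} (hr : 0 < r) (F : EuclideanSpace ℝ (Fin n) → ℝ≥0∞) :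
    (volume (Metric.ball x r))⁻¹ * ∫⁻ y in Metric.ball x r, (annulus n j).indicator F y ≤
      4 ^ n * (volume (Metric.ball (0 : EuclideanSpace ℝ (Fin n)) 1))⁻¹ *
        2 ^ (-((max j k : ℤ) : ℝ) * n) * ∫⁻ y in annulus n j, F y := by
  by_cases hne : ∃ y ∈ Metric.ball x r, y ∈ annulus n j
  · obtain ⟨y, hy, hyj⟩ := hne
    have hrr : (2:ℝ) ^ (max j k - 2) < r := by
      rw [Metric.mem_ball, dist_eq_norm] at hy
      have t1 := norm_sub_norm_le y x
      have t2 := norm_sub_norm_le x y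
      rw [norm_sub_rev] at t2
      obtain ⟨hx1, hx2⟩ := hx
      obtain ⟨hy1, hy2⟩ := hyj
      rcases le_total j k with h | h
      · rw [abs_of_nonpos (by omega)] at hjk
        rw [max_eq_right h]
        have a1 := zpow_le_zpow_right₀ (by norm_num : (1:ℝ) ≤ 2) (show j ≤ k - 2 by omega)
        have a2 : (2:ℝ) ^ (k - 1) = 2 * 2 ^ (k - 2) := by
          rw [← zpow_one_add₀ (by norm_num)]; congr 1; ring
        linarith
      · rw [abs_of_nonneg (by omega)] at hjk
        rw [max_eq_left h]
        have a1 := zpow_le_zpow_right₀ (by norm_num : (1:ℝ) ≤ 2) (show k ≤ j - 2 by omega)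
        have a2 : (2:ℝ) ^ (j - 1) = 2 * 2 ^ (j - 2) := by
          rw [← zpow_one_add₀ (by norm_num)]; congr 1; ring
        linarith
    have hv : (volume (Metric.ball x r))⁻¹ ≤ 4 ^ n *
        (volume (Metric.ball (0 : EuclideanSpace ℝ (Fin n)) 1))⁻¹ * 2 ^ (-((max j k : ℤ) : ℝ) * n) := by
      calc (volume (Metric.ball x r))⁻¹ ≤ (volume (Metric.ball x ((2:ℝ) ^ (max j k - 2))))⁻¹ := by
            gcongr
        _ = _ := by
            rw [aux_vol2, ENNReal.mul_inv (Or.inl (aux_two_ne_zero _)) (Or.inl (aux_two_ne_top _)),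
              ← ENNReal.rpow_neg]
            have : -(((max j k - 2 : ℤ) : ℝ) * n) = 2 * (n:ℝ) + -((max j k : ℤ) : ℝ) * n := by
              push_cast; ring
            rw [this, aux_two_add, ENNReal.rpow_mul]
            norm_num
            ring
    refine mul_le_mul' hv ?_
    refine (setLIntegral_le_lintegral _ _).trans ?_
    rw [lintegral_indicator (aux_annulus_meas n j)]
  · push Not at hne
    have : ∫⁻ y in Metric.ball x r, (annulus n j).indicator F y = 0 := by
      rw [setLIntegral_congr_fun (g := fun _ => 0) measurableSet_ball]
      · simp
      · intro y hy
        simp [hne y hy]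
    rw [this]; simp

theorem aux_dbl {n : ℕ} {q : ℝ} (hq : 1 < q) (A : Set (EuclideanSpace ℝ (Fin n)))
    (F : EuclideanSpace ℝ (Fin n) → ℝ≥0∞) {G : EuclideanSpace ℝ (Fin n) → ℝ≥0∞} (hG : Measurable G) :
    (∫⁻ y in A, (F y + G y) ^ q) ^ (1/q) ≤
      2 * ((∫⁻ y in A, F y ^ q) ^ (1/q) + (∫⁻ y in A, G y ^ q) ^ (1/q)) := by
  have hq0 : 0 < q := by linarith
  have e : ∀ a : ℝ≥0∞, (a ^ (1/q)) ^ q = a := fun a => by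
    rw [← ENNReal.rpow_mul, one_div_mul_cancel hq0.ne', ENNReal.rpow_one]
  have e' : ∀ a : ℝ≥0∞, (a ^ q) ^ (1/q) = a := fun a => by
    rw [← ENNReal.rpow_mul, mul_one_div_cancel hq0.ne', ENNReal.rpow_one]
  calc _ ≤ (∫⁻ y in A, 2 ^ q * (F y ^ q + G y ^ q)) ^ (1/q) := by
        gcongr with y
        refine (ENNReal.rpow_add_le_mul_rpow_add_rpow (F y) (G y) hq.le).trans ?_
        gcongr
        · norm_num
        · linarith
    _ = (2 ^ q * (((∫⁻ y in A, F y ^ q) ^ (1/q)) ^ q + ((∫⁻ y in A, G y ^ q) ^ (1/q)) ^ q)) ^ (1/q) := by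
        rw [lintegral_const_mul' _ _ (aux_two_ne_top q), lintegral_add_right _ (by fun_prop), e, e]
    _ ≤ (2 ^ q * ((∫⁻ y in A, F y ^ q) ^ (1/q) + (∫⁻ y in A, G y ^ q) ^ (1/q)) ^ q) ^ (1/q) := by
        gcongr
        exact ENNReal.add_rpow_le_rpow_add _ _ hq.le
    _ = _ := by
        rw [ENNReal.mul_rpow_of_nonneg _ _ (by positivity), e', e']

noncomputable def auxc (n : ℕ) (b : EuclideanSpace ℝ (Fin n) → ℝ) (j : ℤ) : ℝ :=
  ⨍ z in Metric.ball (0 : EuclideanSpace ℝ (Fin n)) ((2:ℝ) ^ (j + 1)), b z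

theorem auxc_step {n : ℕ} {q : ℝ} (hq : 1 < q) {b : EuclideanSpace ℝ (Fin n) → ℝ} {K : ℝ≥0∞}
    (hb : Measurable b) (hbl : LocallyIntegrable b volume)
    (hLq : ∀ f, eLpNorm (maxComm n b f) (ENNReal.ofReal q) volume ≤
      K * eLpNorm f (ENNReal.ofReal q) volume) (j : ℤ) :
    ‖auxc n b (j + 1) - auxc n b j‖ₑ ≤ 4 ^ n * K := by
  have hq0 : 0 < q := by linarith
  have hR : (0:ℝ) < 2 ^ (j + 1) := by positivity
  have hR' : (0:ℝ) < 2 ^ (j + 1 + 1) := by positivity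
  set B := Metric.ball (0 : EuclideanSpace ℝ (Fin n)) ((2:ℝ) ^ (j + 1)) with hB
  set B' := Metric.ball (0 : EuclideanSpace ℝ (Fin n)) ((2:ℝ) ^ (j + 1 + 1)) with hB'
  have hv : volume B' = 2 ^ n * volume B := by
    rw [hB, hB', aux_vol2, aux_vol2, ← mul_assoc]
    congr 1
    have : ((j + 1 + 1 : ℤ):ℝ) * n = n + ((j + 1 : ℤ):ℝ) * n := by push_cast; ring
    rw [this, aux_two_add]
    simp
  have h0 : volume B ≠ 0 := aux_vol_ne_zero _ hR
  have h1 : volume B ≠ ⊤ := aux_vol_ne_top _ _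
  have h0' : volume B' ≠ 0 := aux_vol_ne_zero _ hR'
  have h1' : volume B' ≠ ⊤ := aux_vol_ne_top _ _
  calc _ ≤ (volume B)⁻¹ * ∫⁻ y in B, ‖auxc n b (j + 1) - b y‖ₑ := aux_mean hbl hR _
    _ ≤ (volume B)⁻¹ * ∫⁻ y in B', ‖auxc n b (j + 1) - b y‖ₑ := by
        refine mul_le_mul' le_rfl (lintegral_mono_set (Metric.ball_subset_ball ?_))
        exact zpow_le_zpow_right₀ (by norm_num) (by omega)
    _ = (volume B)⁻¹ * ∫⁻ y in B', ‖b y - auxc n b (j + 1)‖ₑ := by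
        simp only [enorm_sub_rev]
    _ ≤ (volume B)⁻¹ * (volume B' ^ (1 - 1/q) * (2 ^ n * K * volume B' ^ (1/q))) := by
        gcongr
        refine (aux_holder hq B' (by fun_prop)).trans ?_
        gcongr
        exact aux_osc hq hb hbl hLq hR'
    _ = (volume B)⁻¹ * (volume B' ^ (1 - 1/q) * volume B' ^ (1/q)) * (2 ^ n * K) := by ring
    _ = (volume B)⁻¹ * volume B * (2 ^ n * 2 ^ n * K) := by
        rw [← ENNReal.rpow_add _ _ h0' h1']
        simp only [sub_add_cancel, ENNReal.rpow_one]
        rw [hv]; ring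
    _ = _ := by
        rw [ENNReal.inv_mul_cancel h0 h1, one_mul, ← mul_pow]
        norm_num

theorem auxc_diff {n : ℕ} {b : EuclideanSpace ℝ (Fin n) → ℝ} {D : ℝ≥0∞}
    (h : ∀ j, ‖auxc n b (j + 1) - auxc n b j‖ₑ ≤ D) (j k : ℤ) :
    ‖auxc n b j - auxc n b k‖ₑ ≤ ENNReal.ofReal |((k - j : ℤ):ℝ)| * D := by
  have key : ∀ (m : ℕ) (j : ℤ), ‖auxc n b (j + m) - auxc n b j‖ₑ ≤ m * D := by
    intro m
    induction m with
    | zero => intro j; simp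
    | succ m ih =>
      intro j
      have e : auxc n b (j + (m + 1 : ℕ)) - auxc n b j =
          (auxc n b (j + m + 1) - auxc n b (j + m)) + (auxc n b (j + m) - auxc n b j) := by
        push_cast; rw [← add_assoc]; ring
      rw [e]
      refine (enorm_add_le _ _).trans ?_
      push_cast
      rw [add_mul, one_mul, add_comm]
      gcongr
      · exact ih j
      · exact h _
  rcases le_total j k with hjk | hjk
  · obtain ⟨m, rfl⟩ := Int.exists_add_of_le hjk
    rw [enorm_sub_rev]
    refine (key m j).trans (le_of_eq ?_)
    simp
  · obtain ⟨m, rfl⟩ := Int.exists_add_of_le hjk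
    refine (key m k).trans (le_of_eq ?_)
    simp

/-- The local part. -/
def auxLoc (n : ℕ) (k : ℤ) : Set (EuclideanSpace ℝ (Fin n)) :=
  annulus n (k - 1) ∪ annulus n k ∪ annulus n (k + 1)

theorem auxLoc_meas (n : ℕ) (k : ℤ) : MeasurableSet (auxLoc n k) :=
  ((aux_annulus_meas n _).union (aux_annulus_meas n _)).union (aux_annulus_meas n _)

theorem auxLoc_mem {n : ℕ} {j k : ℤ} (h : ¬ 2 ≤ |j - k|) {y : EuclideanSpace ℝ (Fin n)}
    (hy : y ∈ annulus n j) : y ∈ auxLoc n k := by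
  have : j = k - 1 ∨ j = k ∨ j = k + 1 := by
    rw [not_le, abs_lt] at h; omega
  rcases this with rfl | rfl | rfl
  · exact Or.inl (Or.inl hy)
  · exact Or.inl (Or.inr hy)
  · exact Or.inr hy

theorem aux_pointwise {n : ℕ} (hn : 0 < n) {b g : EuclideanSpace ℝ (Fin n) → ℝ}
    (hb : Measurable b) (hg : Measurable g) {k : ℤ} {x : EuclideanSpace ℝ (Fin n)}
    (hx : x ∈ annulus n k) (c : ℝ) :
    auxE n b g x ≤ auxE n b ((auxLoc n k).indicator g) x +
      (‖b x - c‖ₑ * (∑' j : ℤ, 4 ^ n * (volume (Metric.ball (0 : EuclideanSpace ℝ (Fin n)) 1))⁻¹ *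
        2 ^ (-((max j k : ℤ) : ℝ) * n) * ∫⁻ y in annulus n j, ‖g y‖ₑ) +
      ∑' j : ℤ, 4 ^ n * (volume (Metric.ball (0 : EuclideanSpace ℝ (Fin n)) 1))⁻¹ *
        2 ^ (-((max j k : ℤ) : ℝ) * n) * ∫⁻ y in annulus n j, ‖b y - c‖ₑ * ‖g y‖ₑ) := by
  have : Nonempty (Fin n) := ⟨⟨0, hn⟩⟩
  refine iSup_le fun r => ?_
  set F : EuclideanSpace ℝ (Fin n) → ℝ≥0∞ := fun y => ‖b x - b y‖ₑ * ‖g y‖ₑ with hF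
  have hFm : Measurable F := by fun_prop
  set Φ : ℤ → EuclideanSpace ℝ (Fin n) → ℝ≥0∞ := fun j =>
    if 2 ≤ |j - k| then (annulus n j).indicator F else 0 with hΦ
  have hΦm : ∀ j, Measurable (Φ j) := by
    intro j
    simp only [hΦ]
    split_ifs
    · exact hFm.indicator (aux_annulus_meas n j)
    · exact measurable_zero
  set cc : ℤ → ℝ≥0∞ := fun j => 4 ^ n * (volume (Metric.ball (0 : EuclideanSpace ℝ (Fin n)) 1))⁻¹ *
        2 ^ (-((max j k : ℤ) : ℝ) * n) with hcc
  have hpt : ∀ᵐ y ∂(volume.restrict (Metric.ball x r.1)), F y ≤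
      ‖b x - b y‖ₑ * ‖(auxLoc n k).indicator g y‖ₑ + ∑' j, Φ j y := by
    have : ∀ᵐ y : EuclideanSpace ℝ (Fin n), y ≠ 0 := by
      rw [ae_iff]; simp
    filter_upwards [ae_restrict_of_ae this] with y hy
    obtain ⟨j, hj⟩ := aux_annulus_cover hy
    by_cases h : 2 ≤ |j - k|
    · refine le_add_left ?_
      refine le_trans ?_ (ENNReal.le_tsum j)
      simp [hΦ, h, hj]
    · refine le_add_right ?_
      simp [auxLoc_mem h hj, hF]
  have hfar : ∀ j, (volume (Metric.ball x r.1))⁻¹ * ∫⁻ y in Metric.ball x r.1, Φ j y ≤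
      cc j * (‖b x - c‖ₑ * ∫⁻ y in annulus n j, ‖g y‖ₑ) +
      cc j * ∫⁻ y in annulus n j, ‖b y - c‖ₑ * ‖g y‖ₑ := by
    intro j
    by_cases h : 2 ≤ |j - k|
    · have e : Φ j = (annulus n j).indicator F := by simp [hΦ, h]
      rw [e]
      refine (aux_far h hx r.2 F).trans ?_
      rw [← mul_add]
      refine mul_le_mul' le_rfl ?_
      rw [← lintegral_const_mul _ (by fun_prop), ← lintegral_add_left (by fun_prop)]
      apply lintegral_mono
      intro y
      show ‖b x - b y‖ₑ * ‖g y‖ₑ ≤ ‖b x - c‖ₑ * ‖g y‖ₑ + ‖b y - c‖ₑ * ‖g y‖ₑ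
      rw [← add_mul]
      refine mul_le_mul' ?_ le_rfl
      have : b x - b y = (b x - c) - (b y - c) := by ring
      rw [this]
      exact enorm_sub_le
    · have e : Φ j = 0 := by simp [hΦ, h]
      rw [e]; simp
  calc (volume (Metric.ball x r.1))⁻¹ * ∫⁻ y in Metric.ball x r.1, F y
      ≤ (volume (Metric.ball x r.1))⁻¹ * ∫⁻ y in Metric.ball x r.1,
          (‖b x - b y‖ₑ * ‖(auxLoc n k).indicator g y‖ₑ + ∑' j, Φ j y) :=
        mul_le_mul' le_rfl (lintegral_mono_ae hpt)
    _ = (volume (Metric.ball x r.1))⁻¹ * (∫⁻ y in Metric.ball x r.1,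
          ‖b x - b y‖ₑ * ‖(auxLoc n k).indicator g y‖ₑ) +
        ∑' j, (volume (Metric.ball x r.1))⁻¹ * ∫⁻ y in Metric.ball x r.1, Φ j y := by
        rw [lintegral_add_right _ (Measurable.tsum hΦm),
          lintegral_tsum (fun j => (hΦm j).aemeasurable), mul_add, ENNReal.tsum_mul_left]
    _ ≤ auxE n b ((auxLoc n k).indicator g) x + ∑' j,
        (cc j * (‖b x - c‖ₑ * ∫⁻ y in annulus n j, ‖g y‖ₑ) +
         cc j * ∫⁻ y in annulus n j, ‖b y - c‖ₑ * ‖g y‖ₑ) := by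
        refine add_le_add ?_ (ENNReal.tsum_le_tsum hfar)
        · exact le_iSup (fun r : {r : ℝ // 0 < r} => (volume (Metric.ball x r.1))⁻¹ *
            ∫⁻ y in Metric.ball x r.1, ‖b x - b y‖ₑ * ‖(auxLoc n k).indicator g y‖ₑ) r
    _ = _ := by
        rw [ENNReal.tsum_add, ← ENNReal.tsum_mul_left]
        congr 3
        funext j; ring

theorem aux_local {n : ℕ} {q : ℝ} (hq : 1 < q) {b g : EuclideanSpace ℝ (Fin n) → ℝ} {K : ℝ≥0∞}
    (hK : K ≠ ⊤)
    (hb : Measurable b) (hbl : LocallyIntegrable b volume) (hg : Measurable g)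
    (hLq : ∀ f, eLpNorm (maxComm n b f) (ENNReal.ofReal q) volume ≤
      K * eLpNorm f (ENNReal.ofReal q) volume)
    (hfin : ∀ j, (∫⁻ y in annulus n j, ‖g y‖ₑ ^ q) ^ (1/q) ≠ ⊤) (k : ℤ) :
    (∫⁻ x, auxE n b ((auxLoc n k).indicator g) x ^ q) ^ (1/q) ≤
      K * (2 ^ n * ∑' j, auxW (n * (1 - 1/q)) (n / q) (k - j) *
        (∫⁻ y in annulus n j, ‖g y‖ₑ ^ q) ^ (1/q)) := by
  have hq0 : 0 < q := by linarith
  have hLm := auxLoc_meas n k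
  set L := auxLoc n k with hL
  set Fj : ℤ → ℝ≥0∞ := fun j => (∫⁻ y in annulus n j, ‖g y‖ₑ ^ q) ^ (1/q) with hFj
  have hR : (0:ℝ) < 2 ^ (k + 2) := by positivity
  have hLB : L ⊆ Metric.ball 0 ((2:ℝ) ^ (k + 2)) := by
    refine Set.union_subset (Set.union_subset ?_ ?_) ?_ <;> exact aux_annulus_sub (by omega)
  have hsum : (∫⁻ y in L, ‖g y‖ₑ ^ q) ^ (1/q) ≤ Fj (k - 1) + Fj k + Fj (k + 1) := by
    have hq1 : 1 / q ≤ 1 := by rw [div_le_one hq0]; exact hq.le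
    have hq2 : 0 ≤ 1 / q := by positivity
    calc _ ≤ ((∫⁻ y in annulus n (k - 1), ‖g y‖ₑ ^ q) + (∫⁻ y in annulus n k, ‖g y‖ₑ ^ q) +
          ∫⁻ y in annulus n (k + 1), ‖g y‖ₑ ^ q) ^ (1/q) := by
          refine ENNReal.rpow_le_rpow ?_ hq2
          refine (lintegral_union_le _ _ _).trans ?_
          exact add_le_add (lintegral_union_le _ _ _) le_rfl
      _ ≤ _ := by
          refine (ENNReal.rpow_add_le_add_rpow _ _ hq2 hq1).trans ?_
          exact add_le_add (ENNReal.rpow_add_le_add_rpow _ _ hq2 hq1) le_rfl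
  have hLfin : (∫⁻ y in L, ‖g y‖ₑ ^ q) ^ (1/q) ≠ ⊤ := by
    refine ne_top_of_le_ne_top ?_ hsum
    simp only [ne_eq, ENNReal.add_eq_top, not_or]
    exact ⟨⟨hfin _, hfin _⟩, hfin _⟩
  have hvB : volume (Metric.ball (0 : EuclideanSpace ℝ (Fin n)) ((2:ℝ) ^ (k + 2))) ^ (1 - 1/q) ≠ ⊤ := by
    apply ENNReal.rpow_ne_top_of_nonneg
    · rw [sub_nonneg, div_le_one hq0]; exact hq.le
    · exact aux_vol_ne_top _ _
  have hgm : Measurable (L.indicator g) := hg.indicator hLm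
  have hge : ∀ y, ‖L.indicator g y‖ₑ = L.indicator (fun y => ‖g y‖ₑ) y := by
    intro y; by_cases hy : y ∈ L <;> simp [hy]
  have hEfin : ∀ᵐ x, auxE n b (L.indicator g) x < ⊤ := by
    apply auxE_finite hgm (⨍ z in Metric.ball (0 : EuclideanSpace ℝ (Fin n)) ((2:ℝ) ^ (k + 2)), b z)
    · simp only [hge]
      rw [lintegral_indicator hLm]
      refine ne_top_of_le_ne_top ?_ (aux_holder hq L (by fun_prop))
      refine ENNReal.mul_ne_top (ne_top_of_le_ne_top hvB ?_) hLfin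
      refine ENNReal.rpow_le_rpow (measure_mono hLB) ?_
      rw [sub_nonneg, div_le_one hq0]; exact hq.le
    · have e : ∀ y, ‖b y - ⨍ z in Metric.ball (0 : EuclideanSpace ℝ (Fin n)) ((2:ℝ) ^ (k + 2)), b z‖ₑ *
          ‖L.indicator g y‖ₑ = L.indicator (fun y => ‖b y - ⨍ z in Metric.ball (0 : EuclideanSpace ℝ (Fin n)) ((2:ℝ) ^ (k + 2)), b z‖ₑ * ‖g y‖ₑ) y := by
        intro y; by_cases hy : y ∈ L <;> simp [hy]
      simp only [e]
      rw [lintegral_indicator hLm]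
      refine ne_top_of_le_ne_top ?_ (aux_dual hq hb hbl hg hLq hR hLm hLB)
      exact ENNReal.mul_ne_top (ENNReal.mul_ne_top (ENNReal.mul_ne_top (by simp) hK) hvB) hLfin
  refine (auxE_Lq hq hb hgm hLq hEfin).trans ?_
  refine mul_le_mul' le_rfl ?_
  have e2 : ∫⁻ y, ‖L.indicator g y‖ₑ ^ q = ∫⁻ y in L, ‖g y‖ₑ ^ q := by
    rw [← lintegral_indicator hLm]
    apply lintegral_congr
    intro y; by_cases hy : y ∈ L <;> simp [hy, hq0]
  rw [e2]
  refine hsum.trans ?_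
  have hW : ∀ j, |k - j| ≤ 1 → Fj j ≤ 2 ^ n * (auxW (n * (1 - 1/q)) (n / q) (k - j) * Fj j) := by
    intro j hj
    rw [← mul_assoc]
    refine le_mul_of_one_le_left' ?_
    unfold auxW
    calc (1:ℝ≥0∞) ≤ 2 ^ ((n:ℝ) + -(max (((k - j : ℤ):ℝ) * (n * (1 - 1/q))) (-((k - j : ℤ):ℝ) * (n / q)))) := by
          rw [← ENNReal.rpow_zero (x := 2)]
          apply ENNReal.rpow_le_rpow_of_exponent_le (by norm_num)
          have hj' : |((k - j : ℤ):ℝ)| ≤ 1 := by exact_mod_cast hj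
          rw [abs_le] at hj'
          have h1q : 1/q ≤ 1 := by rw [div_le_one hq0]; exact hq.le
          have h1q' : 0 ≤ 1/q := by positivity
          have hn0 : (0:ℝ) ≤ n := by positivity
          have : max (((k - j : ℤ):ℝ) * (n * (1 - 1/q))) (-((k - j : ℤ):ℝ) * (n / q)) ≤ n := by
            apply max_le
            · have : (n:ℝ) * (1 - 1/q) ≤ n := by nlinarith
              have : 0 ≤ (n:ℝ) * (1 - 1/q) := mul_nonneg hn0 (by linarith)
              nlinarith
            · have : (n:ℝ) / q ≤ n := by rw [div_eq_mul_one_div]; nlinarith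
              have : 0 ≤ (n:ℝ) / q := by positivity
              nlinarith
          linarith
      _ ≤ _ := by
          rw [aux_two_add, ENNReal.rpow_natCast]
          gcongr
          exact le_mul_of_one_le_left' (by simp)
  calc Fj (k - 1) + Fj k + Fj (k + 1) = ∑ j ∈ ({k - 1, k, k + 1} : Finset ℤ), Fj j := by
        rw [Finset.sum_insert, Finset.sum_insert, Finset.sum_singleton, add_assoc]
        · simp
        · simp; omega
    _ ≤ ∑ j ∈ ({k - 1, k, k + 1} : Finset ℤ), 2 ^ n * (auxW (n * (1 - 1/q)) (n / q) (k - j) * Fj j) := by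
        apply Finset.sum_le_sum
        intro j hj
        apply hW
        simp only [Finset.mem_insert, Finset.mem_singleton] at hj
        rw [abs_le]; omega
    _ ≤ ∑' j, 2 ^ n * (auxW (n * (1 - 1/q)) (n / q) (k - j) * Fj j) := ENNReal.sum_le_tsum _
    _ = _ := by rw [ENNReal.tsum_mul_left]

theorem aux_main {n : ℕ} (hn : 0 < n) {q : ℝ} (hq : 1 < q) :
    ∃ C : ℝ≥0∞, C ≠ ⊤ ∧ ∀ (b g : EuclideanSpace ℝ (Fin n) → ℝ) (K : ℝ≥0∞), K ≠ ⊤ →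
    Measurable b → LocallyIntegrable b volume → Measurable g →
    (∀ f, eLpNorm (maxComm n b f) (ENNReal.ofReal q) volume ≤
      K * eLpNorm f (ENNReal.ofReal q) volume) →
    (∀ j, (∫⁻ y in annulus n j, ‖g y‖ₑ ^ q) ^ (1/q) ≠ ⊤) → ∀ k : ℤ,
    (∫⁻ x in annulus n k, auxE n b g x ^ q) ^ (1/q) ≤
      C * K * ∑' j, auxW (n * (1 - 1/q)) (n / q) (k - j) *
        (∫⁻ y in annulus n j, ‖g y‖ₑ ^ q) ^ (1/q) := by
  have hq0 : 0 < q := by linarith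
  have h1q : 0 ≤ 1 - 1/q := by rw [sub_nonneg, div_le_one hq0]; exact hq.le
  set v := volume (Metric.ball (0 : EuclideanSpace ℝ (Fin n)) 1) with hv
  have hv0 : v ≠ 0 := aux_vol_ne_zero _ one_pos
  have hvt : v ≠ ⊤ := aux_vol_ne_top _ _
  refine ⟨2 * (2 ^ n + 2 * (2 * (4 ^ n * v⁻¹ * 4 ^ n * (2 ^ n * v)))), ?_, ?_⟩
  · have : v⁻¹ ≠ ⊤ := ENNReal.inv_ne_top.2 hv0
    finiteness
  intro b g K hK hb hbl hg hLq hfin k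
  set Fj : ℤ → ℝ≥0∞ := fun j => (∫⁻ y in annulus n j, ‖g y‖ₑ ^ q) ^ (1/q) with hFj
  set W : ℤ → ℝ≥0∞ := fun j => auxW (n * (1 - 1/q)) (n / q) (k - j) with hW
  set VB : ℤ → ℝ≥0∞ := fun j => volume (Metric.ball (0 : EuclideanSpace ℝ (Fin n)) ((2:ℝ) ^ (j + 1))) with hVB
  set c := auxc n b k with hc
  set cc : ℤ → ℝ≥0∞ := fun j => 4 ^ n * v⁻¹ * 2 ^ (-((max j k : ℤ) : ℝ) * n) with hcc
  set T1 : ℝ≥0∞ := ∑' j, cc j * ∫⁻ y in annulus n j, ‖g y‖ₑ with hT1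
  set T2 : ℝ≥0∞ := ∑' j, cc j * ∫⁻ y in annulus n j, ‖b y - c‖ₑ * ‖g y‖ₑ with hT2
  have e' : ∀ a : ℝ≥0∞, (a ^ q) ^ (1/q) = a := fun a => by
    rw [← ENNReal.rpow_mul, mul_one_div_cancel hq0.ne', ENNReal.rpow_one]
  have hI1 : ∀ j, ∫⁻ y in annulus n j, ‖g y‖ₑ ≤ VB j ^ (1 - 1/q) * Fj j := by
    intro j
    refine (aux_holder hq (annulus n j) (by fun_prop)).trans ?_
    refine mul_le_mul' (ENNReal.rpow_le_rpow (measure_mono ?_) h1q) le_rfl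
    exact aux_annulus_sub (by omega)
  have hI2 : ∀ j, ∫⁻ y in annulus n j, ‖b y - c‖ₑ * ‖g y‖ₑ ≤
      4 ^ n * K * (1 + ENNReal.ofReal |((k - j : ℤ):ℝ)|) * (VB j ^ (1 - 1/q) * Fj j) := by
    intro j
    calc _ ≤ ∫⁻ y in annulus n j, (‖b y - auxc n b j‖ₑ * ‖g y‖ₑ + ‖auxc n b j - c‖ₑ * ‖g y‖ₑ) := by
          apply lintegral_mono
          intro y
          dsimp only
          rw [← add_mul]
          gcongr
          have : b y - c = (b y - auxc n b j) + (auxc n b j - c) := by ring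
          rw [this]
          exact enorm_add_le _ _
      _ = (∫⁻ y in annulus n j, ‖b y - auxc n b j‖ₑ * ‖g y‖ₑ) +
          ‖auxc n b j - c‖ₑ * ∫⁻ y in annulus n j, ‖g y‖ₑ := by
          rw [lintegral_add_left (by fun_prop), lintegral_const_mul _ (by fun_prop)]
      _ ≤ 2 ^ n * K * VB j ^ (1 - 1/q) * Fj j +
          (ENNReal.ofReal |((k - j : ℤ):ℝ)| * (4 ^ n * K)) * (VB j ^ (1 - 1/q) * Fj j) := by
          gcongr
          · exact aux_dual hq hb hbl hg hLq (by positivity) (aux_annulus_meas n j)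
              (aux_annulus_sub (by omega))
          · exact auxc_diff (auxc_step hq hb hbl hLq) j k
          · exact hI1 j
      _ ≤ 4 ^ n * K * VB j ^ (1 - 1/q) * Fj j +
          (ENNReal.ofReal |((k - j : ℤ):ℝ)| * (4 ^ n * K)) * (VB j ^ (1 - 1/q) * Fj j) := by
          gcongr; norm_num
      _ = _ := by ring
  have hpow : ∀ j, 2 ^ (-((max j k : ℤ) : ℝ) * n) * VB j ^ (1 - 1/q) * VB k ^ (1/q) =
      2 ^ n * v * 2 ^ (-(max (((k - j : ℤ):ℝ) * (n * (1 - 1/q))) (-((k - j : ℤ):ℝ) * (n / q)))) := by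
    intro j
    simp only [hVB, aux_vol2, ← hv]
    rw [ENNReal.mul_rpow_of_nonneg _ _ h1q, ENNReal.mul_rpow_of_nonneg _ _ (by positivity : 0 ≤ 1/q),
      ← ENNReal.rpow_mul, ← ENNReal.rpow_mul]
    have hvv : v ^ (1 - 1/q) * v ^ (1/q) = v := by
      rw [← ENNReal.rpow_add _ _ hv0 hvt]; simp
    calc _ = (2 ^ (-((max j k : ℤ) : ℝ) * n) * 2 ^ (((j + 1 : ℤ):ℝ) * n * (1 - 1/q)) *
          2 ^ (((k + 1 : ℤ):ℝ) * n * (1/q))) * (v ^ (1 - 1/q) * v ^ (1/q)) := by ring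
      _ = 2 ^ ((n:ℝ) + -(max (((k - j : ℤ):ℝ) * (n * (1 - 1/q))) (-((k - j : ℤ):ℝ) * (n / q)))) * v := by
          rw [hvv, ← aux_two_add, ← aux_two_add]
          congr 2
          have hA : 0 ≤ (n:ℝ) * (1 - 1/q) := mul_nonneg (by positivity) h1q
          have hB : 0 ≤ (n:ℝ) / q := by positivity
          rcases le_total j k with h | h
          · have h' : 0 ≤ ((k - j : ℤ):ℝ) := by exact_mod_cast (by omega : 0 ≤ k - j)
            rw [max_eq_right h, max_eq_left (by nlinarith)]
            push_cast; ring
          · have h' : 0 ≤ -((k - j : ℤ):ℝ) := by exact_mod_cast (by omega : 0 ≤ -(k - j))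
            rw [max_eq_left h, max_eq_right (by nlinarith)]
            push_cast; ring
      _ = _ := by rw [aux_two_add, ENNReal.rpow_natCast]; ring
  have hcomb : ∀ j, cc j * (4 ^ n * K * (1 + ENNReal.ofReal |((k - j : ℤ):ℝ)|) * (VB j ^ (1 - 1/q) * Fj j))
      * VB k ^ (1/q) = 4 ^ n * v⁻¹ * 4 ^ n * (2 ^ n * v) * K * (W j * Fj j) := by
    intro j
    calc _ = 4 ^ n * v⁻¹ * 4 ^ n * K * (1 + ENNReal.ofReal |((k - j : ℤ):ℝ)|) *
          (2 ^ (-((max j k : ℤ) : ℝ) * n) * VB j ^ (1 - 1/q) * VB k ^ (1/q)) * Fj j := by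
            simp only [hcc]; ring
      _ = _ := by
            rw [hpow]; simp only [hW, auxW]; ring
  set Q := 4 ^ n * v⁻¹ * 4 ^ n * (2 ^ n * v) with hQ
  have hT2b : T2 * VB k ^ (1/q) ≤ Q * K * ∑' j, W j * Fj j := by
    rw [hT2, ← ENNReal.tsum_mul_right, ← ENNReal.tsum_mul_left]
    refine ENNReal.tsum_le_tsum fun j => ?_
    rw [← hcomb]
    gcongr
    exact hI2 j
  have hT1b : (2 ^ n * K * VB k ^ (1/q)) * T1 ≤ Q * K * ∑' j, W j * Fj j := by
    rw [hT1, ← ENNReal.tsum_mul_left, ← ENNReal.tsum_mul_left]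
    refine ENNReal.tsum_le_tsum fun j => ?_
    rw [← hcomb]
    calc _ ≤ (4 ^ n * K * VB k ^ (1/q)) * (cc j * (VB j ^ (1 - 1/q) * Fj j)) := by
          gcongr
          · norm_num
          · exact hI1 j
      _ = cc j * (4 ^ n * K * 1 * (VB j ^ (1 - 1/q) * Fj j)) * VB k ^ (1/q) := by ring
      _ ≤ _ := by gcongr; simp
  have hosc : (∫⁻ x in annulus n k, ‖b x - c‖ₑ ^ q) ^ (1/q) ≤ 2 ^ n * K * VB k ^ (1/q) := by
    refine le_trans ?_ (aux_osc hq hb hbl hLq (by positivity : (0:ℝ) < 2 ^ (k + 1)))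
    refine ENNReal.rpow_le_rpow (lintegral_mono_set (aux_annulus_sub (by omega))) (by positivity)
  have hvk : volume (annulus n k) ^ (1/q) ≤ VB k ^ (1/q) :=
    ENNReal.rpow_le_rpow (measure_mono (aux_annulus_sub (by omega))) (by positivity)
  have hGn : (∫⁻ x in annulus n k, (‖b x - c‖ₑ * T1 + T2) ^ q) ^ (1/q) ≤
      2 * (2 * (Q * K * ∑' j, W j * Fj j)) := by
    refine (aux_dbl hq _ _ measurable_const).trans ?_
    rw [two_mul (Q * K * ∑' j, W j * Fj j)]
    gcongr
    · simp only [ENNReal.mul_rpow_of_nonneg _ _ hq0.le]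
      rw [lintegral_mul_const _ (by fun_prop), ENNReal.mul_rpow_of_nonneg _ _ (by positivity), e']
      refine le_trans ?_ hT1b
      gcongr
    · rw [setLIntegral_const, ENNReal.mul_rpow_of_nonneg _ _ (by positivity), e']
      refine le_trans ?_ hT2b
      gcongr
  calc _ ≤ (∫⁻ x in annulus n k, (auxE n b ((auxLoc n k).indicator g) x +
        (‖b x - c‖ₑ * T1 + T2)) ^ q) ^ (1/q) := by
        refine ENNReal.rpow_le_rpow ?_ (by positivity)
        apply setLIntegral_mono' (aux_annulus_meas n k)
        intro x hx
        gcongr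
        exact aux_pointwise hn hb hg hx c
    _ ≤ 2 * ((∫⁻ x in annulus n k, auxE n b ((auxLoc n k).indicator g) x ^ q) ^ (1/q) +
        (∫⁻ x in annulus n k, (‖b x - c‖ₑ * T1 + T2) ^ q) ^ (1/q)) :=
        aux_dbl hq _ _ (by fun_prop)
    _ ≤ 2 * (K * (2 ^ n * ∑' j, W j * Fj j) + 2 * (2 * (Q * K * ∑' j, W j * Fj j))) := by
        gcongr
        refine le_trans ?_ (aux_local hq hK hb hbl hg hLq hfin k)
        exact ENNReal.rpow_le_rpow (setLIntegral_le_lintegral _ _) (by positivity)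
    _ = _ := by ring


theorem aux_ae_ne_zero {n : ℕ} (hn : 0 < n) : ∀ᵐ y : EuclideanSpace ℝ (Fin n), y ≠ 0 := by
  have : Nonempty (Fin n) := ⟨⟨0, hn⟩⟩
  rw [ae_iff]; simp

/-- Measurable lower envelope of a possibly non-measurable function. -/
theorem aux_env {n : ℕ} (hn : 0 < n) {q : ℝ} (hq : 1 < q) (f : EuclideanSpace ℝ (Fin n) → ℝ)
    (hfin : ∀ k, ∫⁻ y in annulus n k, ‖f y‖ₑ ^ q ≠ ⊤) :
    ∃ g : EuclideanSpace ℝ (Fin n) → ℝ, Measurable g ∧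
      (∀ k, ∫⁻ y in annulus n k, ‖g y‖ₑ ^ q = ∫⁻ y in annulus n k, ‖f y‖ₑ ^ q) ∧
      ∀ ψ : EuclideanSpace ℝ (Fin n) → ℝ≥0∞, Measurable ψ → (∀ᵐ y, ψ y ≤ ‖f y‖ₑ) →
        ∀ᵐ y, ψ y ≤ ‖g y‖ₑ := by
  have hq0 : 0 < q := by linarith
  have hG := fun k : ℤ => exists_measurable_le_lintegral_eq (volume.restrict (annulus n k))
    (fun y => ‖f y‖ₑ ^ q)
  choose G hGm hGle hGint using hG
  set H : EuclideanSpace ℝ (Fin n) → ℝ≥0∞ := fun y => ∑' k, (annulus n k).indicator (G k) y with hH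
  have hHm : Measurable H :=
    Measurable.tsum fun k => (hGm k).indicator (aux_annulus_meas n k)
  have hHk : ∀ k, ∀ y ∈ annulus n k, H y = G k y := by
    intro k y hy
    simp only [hH]
    rw [tsum_eq_single k]
    · simp [hy]
    · intro j hj
      apply Set.indicator_of_notMem
      intro hyj
      rcases lt_or_gt_of_ne hj with h | h
      · exact aux_annulus_disj h hyj hy
      · exact aux_annulus_disj h hy hyj
  have hHle : ∀ y, H y ≤ ‖f y‖ₑ ^ q := by
    intro y
    by_cases h : ∃ k, y ∈ annulus n k
    · obtain ⟨k, hk⟩ := h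
      rw [hHk k y hk]; exact hGle k y
    · push Not at h
      have : H y = 0 := by simp [hH, h]
      rw [this]; exact zero_le
  have hHt : ∀ y, H y ≠ ⊤ := fun y =>
    ne_top_of_le_ne_top (ENNReal.rpow_ne_top_of_nonneg hq0.le (by simp)) (hHle y)
  have hge : ∀ y, ‖((H y) ^ (1/q)).toReal‖ₑ = (H y) ^ (1/q) := by
    intro y
    rw [Real.enorm_eq_ofReal ENNReal.toReal_nonneg, ENNReal.ofReal_toReal]
    exact ENNReal.rpow_ne_top_of_nonneg (by positivity) (hHt y)
  have hgq : ∀ y, ‖((H y) ^ (1/q)).toReal‖ₑ ^ q = H y := by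
    intro y
    rw [hge, ← ENNReal.rpow_mul, one_div_mul_cancel hq0.ne', ENNReal.rpow_one]
  refine ⟨fun y => ((H y) ^ (1/q)).toReal, by fun_prop, ?_, ?_⟩
  · intro k
    simp only [hgq]
    rw [hGint k]
    exact setLIntegral_congr_fun (aux_annulus_meas n k) (hHk k)
  · intro ψ hψ hle
    have hk : ∀ k, ∀ᵐ y, y ∈ annulus n k → ψ y ≤ ‖((H y) ^ (1/q)).toReal‖ₑ := by
      intro k
      rw [← ae_restrict_iff' (aux_annulus_meas n k)]
      have h1 : G k =ᵐ[volume.restrict (annulus n k)] fun y => max (G k y) (ψ y ^ q) := by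
        apply ae_eq_of_ae_le_of_lintegral_le
        · exact Filter.Eventually.of_forall fun y => le_max_left _ _
        · rw [← hGint k]; exact hfin k
        · exact ((hGm k).max (hψ.pow_const q)).aemeasurable
        · rw [← hGint k]
          apply lintegral_mono_ae
          filter_upwards [ae_restrict_of_ae hle] with y hy
          exact max_le (hGle k y) (ENNReal.rpow_le_rpow hy hq0.le)
      filter_upwards [h1, ae_restrict_mem (aux_annulus_meas n k)] with y hy hyk
      rw [hge, hHk k y hyk, hy]
      calc ψ y = (ψ y ^ q) ^ (1/q) := by
            rw [← ENNReal.rpow_mul, mul_one_div_cancel hq0.ne', ENNReal.rpow_one]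
        _ ≤ _ := ENNReal.rpow_le_rpow (le_max_right _ _) (by positivity)
    filter_upwards [ae_all_iff.2 hk, aux_ae_ne_zero hn] with y hy hy0
    obtain ⟨k, hyk⟩ := aux_annulus_cover hy0
    exact hy k hyk

theorem aux_maxComm_le {n : ℕ} {b f g : EuclideanSpace ℝ (Fin n) → ℝ}
    (hb : Measurable b)
    (hfg : ∀ ψ : EuclideanSpace ℝ (Fin n) → ℝ≥0∞, Measurable ψ → (∀ᵐ y, ψ y ≤ ‖f y‖ₑ) →
        ∀ᵐ y, ψ y ≤ ‖g y‖ₑ) (x : EuclideanSpace ℝ (Fin n)) :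
    ‖maxComm n b f x‖ₑ ≤ auxE n b g x := by
  have hnn : 0 ≤ maxComm n b f x :=
    Real.iSup_nonneg fun r => mul_nonneg (by positivity)
      (integral_nonneg fun y => by positivity)
  rw [Real.enorm_eq_ofReal hnn]
  by_cases hE : auxE n b g x = ⊤
  · rw [hE]; exact le_top
  rw [ENNReal.ofReal_le_iff_le_toReal hE]
  refine Real.iSup_le (fun r => ?_) ENNReal.toReal_nonneg
  rw [← ENNReal.ofReal_le_iff_le_toReal hE]
  by_cases hInt : Integrable (fun y => |b x - b y| * |f y|) (volume.restrict (Metric.ball x r.1))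
  swap
  · rw [integral_undef hInt]; simp
  have hv0 := aux_vol_ne_zero x r.2
  have hvt := aux_vol_ne_top x r.1
  rw [ENNReal.ofReal_mul (by positivity), ENNReal.ofReal_inv_of_pos (ENNReal.toReal_pos hv0 hvt),
    ENNReal.ofReal_toReal hvt, ofReal_integral_eq_lintegral_ofReal hInt
      (Filter.Eventually.of_forall fun y => by positivity)]
  refine le_trans ?_ (le_iSup (fun r : {r : ℝ // 0 < r} => (volume (Metric.ball x r.1))⁻¹ *
            ∫⁻ y in Metric.ball x r.1, ‖b x - b y‖ₑ * ‖g y‖ₑ) r)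
  refine mul_le_mul' le_rfl (lintegral_mono_ae ?_)
  have hms : MeasurableSet (Metric.ball x r.1) := measurableSet_ball
  set Φ := hInt.1.mk _ with hΦ
  have hΦm : Measurable Φ := hInt.1.stronglyMeasurable_mk.measurable
  have hΦe := hInt.1.ae_eq_mk
  rw [← hΦ] at hΦe
  have hbm : MeasurableSet {y | b y ≠ b x} := (measurableSet_eq_fun hb measurable_const).compl
  have hψm : Measurable ((Metric.ball x r.1 ∩ {y | b y ≠ b x}).indicator
      (fun y => ‖Φ y‖ₑ / ‖b x - b y‖ₑ)) :=
    Measurable.indicator (by fun_prop) (hms.inter hbm)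
  have key : ∀ y, |b x - b y| * |f y| = Φ y → b y ≠ b x → ‖Φ y‖ₑ / ‖b x - b y‖ₑ = ‖f y‖ₑ := by
    intro y hy hne
    rw [← hy, enorm_mul, Real.enorm_abs, Real.enorm_abs, mul_comm,
      ENNReal.mul_div_cancel_right _ (by simp)]
    rw [enorm_ne_zero]
    exact sub_ne_zero.2 hne.symm
  have hle := hfg _ hψm (by
    filter_upwards [(ae_restrict_iff' hms).1 hΦe] with y hy
    by_cases hyS : y ∈ Metric.ball x r.1 ∩ {y | b y ≠ b x}
    · rw [Set.indicator_of_mem hyS]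
      exact (key y (hy hyS.1) hyS.2).le
    · rw [Set.indicator_of_notMem hyS]; exact zero_le)
  filter_upwards [hΦe, ae_restrict_of_ae hle, ae_restrict_mem hms] with y hy1 hy2 hy3
  by_cases hbe : b y = b x
  · simp [hbe]
  · have hmem : y ∈ Metric.ball x r.1 ∩ {y | b y ≠ b x} := ⟨hy3, hbe⟩
    rw [Set.indicator_of_mem hmem, key y hy1 hbe] at hy2
    rw [← Real.enorm_eq_ofReal (by positivity), enorm_mul, Real.enorm_abs, Real.enorm_abs]
    exact mul_le_mul' le_rfl hy2

theorem aux_maxComm_congr {n : ℕ} {b b' : EuclideanSpace ℝ (Fin n) → ℝ} (h : b =ᵐ[volume] b')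
    (f : EuclideanSpace ℝ (Fin n) → ℝ) : maxComm n b f =ᵐ[volume] maxComm n b' f := by
  filter_upwards [h] with x hx
  unfold maxComm
  congr 1
  funext r
  congr 1
  apply integral_congr_ae
  filter_upwards [ae_restrict_of_ae h] with y hy
  rw [hx, hy]

theorem aux_herz_congr {n : ℕ} {α lam p q : ℝ} {f g : EuclideanSpace ℝ (Fin n) → ℝ}
    (h : f =ᵐ[volume] g) : herzMorreyNorm n α lam p q f = herzMorreyNorm n α lam p q g := by
  unfold herzMorreyNorm
  congr 1
  funext k₀
  congr 3
  funext k
  congr 2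
  apply eLpNorm_congr_ae
  filter_upwards [h] with x hx
  simp [Set.indicator, hx]

theorem aux_herz_eq {n : ℕ} {α lam p q : ℝ} (hq : 1 < q) (f : EuclideanSpace ℝ (Fin n) → ℝ) :
    herzMorreyNorm n α lam p q f =
      auxN α lam p (fun k => (∫⁻ y in annulus n k, ‖f y‖ₑ ^ q) ^ (1/q)) := by
  have hq0 : 0 < q := by linarith
  unfold herzMorreyNorm auxN
  congr 1
  funext k₀
  congr 3
  funext k
  congr 2
  dsimp only
  rw [aux_eLp hq, ← lintegral_indicator (aux_annulus_meas n _)]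
  congr 1
  apply lintegral_congr
  intro y
  by_cases hy : y ∈ annulus n k.1 <;> simp [hy, hq0]

theorem aux_N_zero {α lam p : ℝ} (hp : 0 < p) : auxN α lam p (fun _ => 0) = 0 := by
  unfold auxN
  simp [hp]

theorem aux_N_fin {α lam p : ℝ} (hp : 0 < p) {F : ℤ → ℝ≥0∞} (h : auxN α lam p F ≠ ⊤) (k : ℤ) :
    F k ≠ ⊤ := by
  intro hk
  apply h
  rw [eq_top_iff]
  refine le_trans ?_ (le_iSup _ k)
  have h1 : (⊤:ℝ≥0∞) ≤ ∑' j : {j : ℤ // j ≤ k}, (2:ℝ≥0∞) ^ ((j.1:ℝ) * α * p) * F j.1 ^ p := by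
    refine le_trans ?_ (ENNReal.le_tsum ⟨k, le_rfl⟩)
    rw [hk, ENNReal.top_rpow_of_pos hp, ENNReal.mul_top (aux_two_ne_zero _)]
  rw [top_le_iff.1 h1, ENNReal.top_rpow_of_pos (by positivity), ENNReal.mul_top (aux_two_ne_zero _)]

/-- The case of vanishing constant. -/
theorem aux_zero {n : ℕ} {q : ℝ} (hq : 1 < q) {b : EuclideanSpace ℝ (Fin n) → ℝ}
    (hb : Measurable b) (hbl : LocallyIntegrable b volume)
    (hLq : ∀ f, eLpNorm (maxComm n b f) (ENNReal.ofReal q) volume ≤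
      0 * eLpNorm f (ENNReal.ofReal q) volume) (f : EuclideanSpace ℝ (Fin n) → ℝ) :
    maxComm n b f =ᵐ[volume] fun _ => 0 := by
  have hq0 : 0 < q := by linarith
  have hc : ∀ j, auxc n b j = auxc n b 0 := by
    intro j
    have := auxc_diff (auxc_step hq hb hbl hLq) j 0
    simp only [mul_zero, nonpos_iff_eq_zero, enorm_eq_zero] at this
    linarith
  have hj : ∀ j : ℤ, ∀ᵐ x, x ∈ Metric.ball (0 : EuclideanSpace ℝ (Fin n)) ((2:ℝ) ^ (j + 1)) →
      b x = auxc n b 0 := by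
    intro j
    rw [← ae_restrict_iff' measurableSet_ball]
    have h := aux_osc hq hb hbl hLq (by positivity : (0:ℝ) < 2 ^ (j + 1))
    change (∫⁻ x in _, ‖b x - auxc n b j‖ₑ ^ q) ^ (1/q) ≤ _ at h
    rw [mul_zero, zero_mul, nonpos_iff_eq_zero, ENNReal.rpow_eq_zero_iff_of_pos (by positivity),
      lintegral_eq_zero_iff (by fun_prop)] at h
    filter_upwards [h] with x hx
    simp only [Pi.zero_apply, ENNReal.rpow_eq_zero_iff_of_pos hq0, enorm_eq_zero] at hx
    rw [hc] at hx
    linarith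
  have hba : ∀ᵐ x, b x = auxc n b 0 := by
    filter_upwards [ae_all_iff.2 hj] with x hx
    obtain ⟨m, hm⟩ := pow_unbounded_of_one_lt ‖x‖ (one_lt_two : (1:ℝ) < 2)
    refine hx ((m:ℤ) - 1) ?_
    simpa using hm
  filter_upwards [hba] with x hx
  unfold maxComm
  have : ∀ r : {r : ℝ // 0 < r}, ((volume (Metric.ball x r.1)).toReal)⁻¹ *
    ∫ y in Metric.ball x r.1, |b x - b y| * |f y| = 0 := by
    intro r
    rw [integral_eq_zero_of_ae, mul_zero]
    filter_upwards [ae_restrict_of_ae hba] with y hy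
    simp [hx, hy]
  simp [this]

theorem aux_final {n : ℕ} {α lam p q : ℝ} (hn : 0 < n)
    (hlam : 0 ≤ lam) (hp : 0 < p) (hq : 1 < q)
    (hα₁ : -((n:ℝ)/q) + lam < α) (hα₂ : α < n * (1 - 1/q))
    {b : EuclideanSpace ℝ (Fin n) → ℝ} {M : ℝ} (hM : 0 ≤ M)
    (hbm : Measurable b) (hb : LocallyIntegrable b volume) {Cq : ℝ}
    (hLq : ∀ f, eLpNorm (maxComm n b f) (ENNReal.ofReal q) volume ≤
      ENNReal.ofReal Cq * ENNReal.ofReal M * eLpNorm f (ENNReal.ofReal q) volume) :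
    ∃ C : ℝ≥0∞, C ≠ ⊤ ∧ ∀ f,
      herzMorreyNorm n α lam p q (maxComm n b f) ≤
        C * ENNReal.ofReal M * herzMorreyNorm n α lam p q f := by
  have hq0 : 0 < q := by linarith
  obtain ⟨C1, hC1, h1⟩ := aux_main hn hq
  obtain ⟨C2, hC2, h2⟩ := aux_seq hlam hp hα₁ hα₂
  refine ⟨C2 * C1 * ENNReal.ofReal Cq + 1, by finiteness, fun f => ?_⟩
  rcases hM.eq_or_lt with hM0 | hM0
  · have hL0 : ∀ f, eLpNorm (maxComm n b f) (ENNReal.ofReal q) volume ≤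
      0 * eLpNorm f (ENNReal.ofReal q) volume := by
      intro f; simpa [← hM0] using hLq f
    rw [aux_herz_congr (aux_zero hq hbm hb hL0 f), aux_herz_eq hq]
    simp [hq0, aux_N_zero hp]
  by_cases ht : herzMorreyNorm n α lam p q f = ⊤
  · rw [ht, ENNReal.mul_top]
    · exact le_top
    · simp [hM0]
  have hF := aux_N_fin hp (aux_herz_eq hq f ▸ ht)
  have hF' : ∀ k, ∫⁻ y in annulus n k, ‖f y‖ₑ ^ q ≠ ⊤ := by
    intro k hk
    apply hF k
    simp only [hk]
    exact ENNReal.top_rpow_of_pos (by positivity)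
  obtain ⟨g, hg, hgf, hψ⟩ := aux_env hn hq f hF'
  have h3 := h1 b g (ENNReal.ofReal Cq * ENNReal.ofReal M) (by finiteness) hbm hb hg hLq
    (by intro j; rw [hgf]; exact hF j)
  simp only [hgf] at h3
  rw [aux_herz_eq hq, aux_herz_eq hq]
  refine (h2 (C1 * (ENNReal.ofReal Cq * ENNReal.ofReal M)) _ _ (fun k => le_trans ?_ (h3 k))).trans ?_
  · refine ENNReal.rpow_le_rpow (lintegral_mono fun x => ?_) (by positivity)
    exact ENNReal.rpow_le_rpow (aux_maxComm_le hbm hψ x) hq0.le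
  · refine mul_le_mul' ?_ le_rfl
    calc C2 * (C1 * (ENNReal.ofReal Cq * ENNReal.ofReal M))
        = C2 * C1 * ENNReal.ofReal Cq * ENNReal.ofReal M := by ring
      _ ≤ _ := by gcongr; exact le_self_add


/-- Boundedness of the maximal commutator `M_b`, `b ∈ BMO`, on the Herz–Morrey
space `MK̇^{α,λ}_{p,q}(ℝⁿ)` for `-n/q + λ < α < n(1-1/q)`, assuming its `L^q`
boundedness. -/
theorem stmt_15 (n : ℕ) (α lam p q : ℝ)
    (hlam : 0 ≤ lam) (hp : 0 < p) (hq : 1 < q)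
    (hα₁ : -((n:ℝ)/q) + lam < α) (hα₂ : α < n * (1 - 1/q))
    (b : EuclideanSpace ℝ (Fin n) → ℝ) (M : ℝ) (hM : 0 ≤ M)
    (hb : LocallyIntegrable b volume)
    (hBMO : ∀ (x : EuclideanSpace ℝ (Fin n)) (r : ℝ), 0 < r →
      ⨍ y in Metric.ball x r, |b y - ⨍ z in Metric.ball x r, b z| ≤ M)
    (Cq : ℝ)
    (hLq : ∀ f, eLpNorm (maxComm n b f) (ENNReal.ofReal q) volume ≤
      ENNReal.ofReal Cq * ENNReal.ofReal M * eLpNorm f (ENNReal.ofReal q) volume) :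
    ∃ C : ℝ≥0∞, C ≠ ⊤ ∧ ∀ f,
      herzMorreyNorm n α lam p q (maxComm n b f) ≤
        C * ENNReal.ofReal M * herzMorreyNorm n α lam p q f := by
  have hn : 0 < n := by
    rcases Nat.eq_zero_or_pos n with rfl | h
    · norm_num at hα₁ hα₂
      linarith
    · exact h
  have hbs := hb.aestronglyMeasurable
  have he : b =ᵐ[volume] hbs.mk b := hbs.ae_eq_mk
  have hb' : LocallyIntegrable (hbs.mk b) volume := by
    intro x
    obtain ⟨s, hs, hi⟩ := hb x
    exact ⟨s, hs, hi.congr (ae_restrict_of_ae he)⟩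
  obtain ⟨C, hC, h⟩ := aux_final hn hlam hp hq hα₁ hα₂ hM
    hbs.stronglyMeasurable_mk.measurable hb' (Cq := Cq) (by
      intro f
      rw [← eLpNorm_congr_ae (aux_maxComm_congr he f)]
      exact hLq f)
  refine ⟨C, hC, fun f => ?_⟩
  rw [aux_herz_congr (aux_maxComm_congr he f)]
  exact h f
end

section
/- Let b ∈ BMO(ℝⁿ), 1 < q < ∞, and let j ≤ k − 3 be integers. If f is supported in the annulus A_j = {2^{j-1} < |x| ≤ 2^j}, then the maximal commutator satisfies ‖(M_b f)χ_{A_k}‖_{L^q} ≤ C ‖b‖_{BMO} (k − j) 2^{(j−k)n(1−1/q)} ‖f‖_{L^q}, with C depending only on n and q. -/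
open MeasureTheory ENNReal

namespace JN
open Metric Set Filter Topology

variable {n : ℕ}

/-- Average over a closed ball. -/
noncomputable def av (b : EuclideanSpace ℝ (Fin n) → ℝ) (x : EuclideanSpace ℝ (Fin n)) (r : ℝ) : ℝ :=
  ⨍ y in closedBall x r, b y

/-- BMO hypothesis on closed balls. -/
def IsBMO (b : EuclideanSpace ℝ (Fin n) → ℝ) (M : ℝ) : Prop :=
  ∀ x r, 0 < r → ∫⁻ y in closedBall x r, ‖b y - av b x r‖ₑ ≤
    ENNReal.ofReal M * volume (closedBall x r)

lemma vol_pos (x : EuclideanSpace ℝ (Fin n)) {r : ℝ} (hr : 0 < r) :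
    volume (closedBall x r) ≠ 0 := (measure_closedBall_pos volume x hr).ne'

lemma vol_top (x : EuclideanSpace ℝ (Fin n)) {r : ℝ} :
    volume (closedBall x r) ≠ ⊤ := measure_closedBall_lt_top.ne

lemma vol_mul (x y : EuclideanSpace ℝ (Fin n)) {s t : ℝ} (hs : 0 ≤ s) (ht : 0 ≤ t) :
    volume (closedBall x (s * t)) = ENNReal.ofReal (s ^ n) * volume (closedBall y t) := by
  rw [Measure.addHaar_closedBall_mul volume x hs ht, Measure.addHaar_closedBall_center volume y t]
  simp

lemma ball_ae_eq (x : EuclideanSpace ℝ (Fin n)) {r : ℝ} (hr : 0 < r) :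
    ball x r =ᵐ[volume] closedBall x r := by
  refine ae_eq_set.2 ⟨?_, ?_⟩
  · rw [sdiff_eq_empty.2 ball_subset_closedBall]; simp
  · rw [closedBall_sdiff_ball]; exact Measure.addHaar_sphere_of_ne_zero volume x hr.ne'

lemma integrableOn_cb {b : EuclideanSpace ℝ (Fin n) → ℝ} (hb : LocallyIntegrable b volume)
    (x : EuclideanSpace ℝ (Fin n)) (r : ℝ) : IntegrableOn b (closedBall x r) volume :=
  hb.integrableOn_isCompact (isCompact_closedBall x r)

lemma isBMO_of {b : EuclideanSpace ℝ (Fin n) → ℝ} {M : ℝ} (hb : LocallyIntegrable b volume)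
    (h : ∀ (x : EuclideanSpace ℝ (Fin n)) (r : ℝ), 0 < r →
        ⨍ y in Metric.ball x r, |b y - ⨍ z in Metric.ball x r, b z| ≤ M) : IsBMO b M := by
  intro x r hr
  have h1 := h x r hr
  rw [Measure.restrict_congr_set (ball_ae_eq x hr)] at h1
  change ⨍ y in closedBall x r, |b y - av b x r| ≤ M at h1
  have hi : IntegrableOn (fun y => b y - av b x r) (closedBall x r) volume :=
    (integrableOn_cb hb x r).sub (integrableOn_const (vol_top x))
  have h2 : ∫⁻ y in closedBall x r, ‖b y - av b x r‖ₑ =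
      ENNReal.ofReal (∫ y in closedBall x r, |b y - av b x r|) := by
    rw [ofReal_integral_eq_lintegral_ofReal hi.abs (ae_of_all _ fun _ => abs_nonneg _)]
    simp [← Real.enorm_eq_ofReal_abs]
  rw [h2]
  rw [setAverage_eq, smul_eq_mul, inv_mul_le_iff₀ (show 0 < volume.real (closedBall x r) from ENNReal.toReal_pos (vol_pos x hr) (vol_top x))] at h1
  refine (ENNReal.ofReal_le_ofReal h1).trans ?_
  rw [mul_comm, ENNReal.ofReal_mul' measureReal_nonneg]
  simp [Measure.real, vol_top]

lemma M_nonneg {b : EuclideanSpace ℝ (Fin n) → ℝ} {M : ℝ}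
    (h : ∀ (x : EuclideanSpace ℝ (Fin n)) (r : ℝ), 0 < r →
        ⨍ y in Metric.ball x r, |b y - ⨍ z in Metric.ball x r, b z| ≤ M) : 0 ≤ M := by
  refine le_trans ?_ (h 0 1 one_pos)
  rw [setAverage_eq, smul_eq_mul]
  positivity

lemma av_sub_mul_le {b : EuclideanSpace ℝ (Fin n) → ℝ} (hb : LocallyIntegrable b volume)
    (x : EuclideanSpace ℝ (Fin n)) {s : ℝ} (hs : 0 < s) (c : ℝ) :
    ‖av b x s - c‖ₑ * volume (closedBall x s) ≤ ∫⁻ y in closedBall x s, ‖b y - c‖ₑ := by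
  have h0 : 0 < volume.real (closedBall x s) := ENNReal.toReal_pos (vol_pos x hs) (vol_top x)
  have h1 : (volume.real (closedBall x s)) * (av b x s - c) = ∫ y in closedBall x s, (b y - c) := by
    rw [integral_sub (integrableOn_cb hb x s) (integrableOn_const (vol_top x)), av, setAverage_eq,
      setIntegral_const, smul_eq_mul, smul_eq_mul]
    field_simp
  have h2 := enorm_integral_le_lintegral_enorm (μ := volume.restrict (closedBall x s))
    (fun y => b y - c)
  rw [← h1, enorm_mul] at h2
  refine le_trans (le_of_eq ?_) h2
  rw [mul_comm, Real.enorm_eq_ofReal h0.le]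
  simp [Measure.real, vol_top]

/-- comparison of averages -/
lemma av_compare {b : EuclideanSpace ℝ (Fin n) → ℝ} {M : ℝ} (hM : 0 ≤ M)
    (hb : LocallyIntegrable b volume)
    (H : IsBMO b M) (x y : EuclideanSpace ℝ (Fin n)) {s : ℝ} (hs : 0 < s)
    (hst : closedBall x s ⊆ closedBall y (2 * s)) :
    |av b x s - av b y (2 * s)| ≤ 2 ^ n * M := by
  have h1 := (av_sub_mul_le hb x hs (av b y (2 * s))).trans
    ((lintegral_mono_set hst).trans (H y (2 * s) (by positivity)))
  rw [vol_mul y x (by norm_num) hs.le, ← mul_assoc,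
    ENNReal.mul_le_mul_iff_left (vol_pos x hs) (vol_top x), ← ENNReal.ofReal_mul hM,
    Real.enorm_eq_ofReal_abs, ENNReal.ofReal_le_ofReal_iff (by positivity)] at h1
  linarith


noncomputable def cA (n : ℕ) : ℝ := 2 ^ n * (1 + 2 ^ n)
noncomputable def cT (n : ℕ) : ℝ := cA n * (2 * 4 ^ n)
noncomputable def cK (n : ℕ) : ℝ := cT n + 2 ^ n

lemma cA_pos (n : ℕ) : 0 < cA n := by unfold cA; positivity
lemma cA_le (n : ℕ) : cA n ≤ cT n := by
  unfold cT
  have := cA_pos n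
  have h : (1:ℝ) ≤ 4 ^ n := one_le_pow₀ (by norm_num)
  nlinarith
lemma cT_pos (n : ℕ) : 0 < cT n := (cA_pos n).trans_le (cA_le n)
lemma cK_pos (n : ℕ) : 0 < cK n := by have := cT_pos n; unfold cK; positivity

lemma osc_double {b : EuclideanSpace ℝ (Fin n) → ℝ} {M : ℝ} (hM : 0 ≤ M)
    (hb : LocallyIntegrable b volume)
    (H : IsBMO b M) (x : EuclideanSpace ℝ (Fin n)) {r : ℝ} (hr : 0 < r) :
    ∫⁻ y in closedBall x (2 * r), ‖b y - av b x r‖ₑ ≤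
      ENNReal.ofReal (cA n * M) * volume (closedBall x r) := by
  have h1 : ∀ y, ‖b y - av b x r‖ₑ ≤ ‖b y - av b x (2 * r)‖ₑ + ENNReal.ofReal (2 ^ n * M) := by
    intro y
    have h2 : b y - av b x r = (b y - av b x (2 * r)) - (av b x r - av b x (2 * r)) := by ring
    rw [h2]
    refine (enorm_sub_le).trans (add_le_add le_rfl ?_)
    rw [Real.enorm_eq_ofReal_abs]
    exact ENNReal.ofReal_le_ofReal
      (av_compare hM hb H x x hr (closedBall_subset_closedBall (by linarith)))
  calc _ ≤ ∫⁻ y in closedBall x (2 * r),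
        (‖b y - av b x (2 * r)‖ₑ + ENNReal.ofReal (2 ^ n * M)) := lintegral_mono h1
    _ = (∫⁻ y in closedBall x (2 * r), ‖b y - av b x (2 * r)‖ₑ) +
        ENNReal.ofReal (2 ^ n * M) * volume (closedBall x (2 * r)) := by
      rw [lintegral_add_right _ measurable_const]; simp
    _ ≤ ENNReal.ofReal M * volume (closedBall x (2 * r)) +
        ENNReal.ofReal (2 ^ n * M) * volume (closedBall x (2 * r)) := by
      gcongr
      exact H x (2 * r) (by positivity)
    _ = ENNReal.ofReal (cA n * M) * volume (closedBall x r) := by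
      rw [vol_mul x x (by norm_num) hr.le, ← add_mul, ← ENNReal.ofReal_add hM (by positivity),
        ← mul_assoc, ← ENNReal.ofReal_mul (by positivity)]
      congr 1
      have e : (M + 2 ^ n * M) * 2 ^ n = cA n * M := by unfold cA; ring
      rw [e]

lemma stopping {b : EuclideanSpace ℝ (Fin n) → ℝ} {M : ℝ} (hM : 0 ≤ M)
    (hb : LocallyIntegrable b volume)
    (H : IsBMO b M) (x : EuclideanSpace ℝ (Fin n)) {r : ℝ} (hr : 0 < r) :
    ∀ᵐ y, y ∈ closedBall x r → cT n * M < |b y - av b x r| →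
      ∃ ρ, 0 < ρ ∧ ρ ≤ r ∧ cT n * M < |av b y ρ - av b x r| ∧
        |av b y (2 * ρ) - av b x r| ≤ cT n * M := by
  filter_upwards [IsUnifLocDoublingMeasure.ae_tendsto_average volume hb 1] with y hy hyB hyT
  have hδ : Tendsto (fun i : ℕ => r * (1 / 2 : ℝ) ^ i) atTop (𝓝[>] 0) := by
    refine tendsto_nhdsWithin_iff.2 ⟨?_, Eventually.of_forall fun i => ?_⟩
    · simpa using (tendsto_pow_atTop_nhds_zero_of_lt_one (r := (1/2:ℝ)) (by norm_num)
        (by norm_num)).const_mul r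
    · exact mul_pos hr (by positivity)
  have h1 := hy (fun _ : ℕ => y) _ hδ (Eventually.of_forall fun i =>
    mem_closedBall_self (by positivity))
  have h2 : Tendsto (fun i : ℕ => |av b y (r * (1 / 2 : ℝ) ^ i) - av b x r|) atTop
    (𝓝 |b y - av b x r|) := (h1.sub_const _).abs
  have h3 : ∃ i : ℕ, cT n * M < |av b y (r * (1 / 2 : ℝ) ^ i) - av b x r| :=
    (h2.eventually (lt_mem_nhds hyT)).exists
  classical
  have hf := Nat.find_spec h3
  have hm := fun i => Nat.find_min h3 (m := i)
  generalize Nat.find h3 = N at hf hm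
  rcases N with _ | N
  · exfalso
    have h4 : closedBall y r ⊆ closedBall x (2 * r) := by
      refine closedBall_subset_closedBall' ?_
      have := mem_closedBall.1 hyB
      linarith
    have h5 := (av_sub_mul_le hb y hr (av b x r)).trans
      ((lintegral_mono_set h4).trans (osc_double hM hb H x hr))
    rw [Measure.addHaar_closedBall_center volume x, Measure.addHaar_closedBall_center volume y,
      ENNReal.mul_le_mul_iff_left (vol_pos _ hr) (vol_top _),
      Real.enorm_eq_ofReal_abs, ENNReal.ofReal_le_ofReal_iff
        (mul_nonneg (cA_pos n).le hM)] at h5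
    simp only [pow_zero, mul_one] at hf
    have := mul_le_mul_of_nonneg_right (cA_le n) hM
    linarith
  · refine ⟨r * (1 / 2) ^ (N + 1), by positivity, ?_, hf, ?_⟩
    · exact mul_le_of_le_one_right hr.le (pow_le_one₀ (by norm_num) (by norm_num))
    · have := hm N (Nat.lt_succ_self N)
      rw [not_lt] at this
      have e : 2 * (r * (1 / 2 : ℝ) ^ (N + 1)) = r * (1 / 2 : ℝ) ^ N := by rw [pow_succ]; ring
      rw [e]
      exact this

lemma decay {b : EuclideanSpace ℝ (Fin n) → ℝ} {M : ℝ} (hM : 0 < M)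
    (hb : LocallyIntegrable b volume)
    (H : IsBMO b M) (m : ℕ) : ∀ (x : EuclideanSpace ℝ (Fin n)) (r : ℝ), 0 < r →
    volume {y | y ∈ closedBall x r ∧ m * (cK n * M) < |b y - av b x r|} ≤
      (2⁻¹ : ℝ≥0∞) ^ m * volume (closedBall x r) := by
  induction m with
  | zero =>
    intro x r hr
    rw [pow_zero, one_mul]
    exact measure_mono fun y hy => hy.1
  | succ m ih =>
    intro x r hr
    set a := av b x r with ha
    let t : Set (EuclideanSpace ℝ (Fin n) × ℝ) := {z | z.1 ∈ closedBall x r ∧ 0 < z.2 ∧ z.2 ≤ r ∧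
      cT n * M < |av b z.1 z.2 - a| ∧ |av b z.1 (2 * z.2) - a| ≤ cT n * M}
    obtain ⟨u, hut, hdisj, hcov⟩ := Vitali.exists_disjoint_subfamily_covering_enlargement_closedBall
      t (fun z => z.1) (fun z => z.2) r (fun z hz => hz.2.2.1) 4 (by norm_num)
    have hcount : u.Countable := hdisj.countable_of_nonempty_interior fun z hz =>
      ⟨z.1, ball_subset_interior_closedBall (mem_ball_self (hut hz).2.1)⟩
    -- total mass
    have hsum : 2 * ∑' z : u, volume (closedBall z.1.1 (4 * z.1.2)) ≤ volume (closedBall x r) := by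
      have e1 : ∀ z : u, volume (closedBall z.1.1 (4 * z.1.2)) =
          ENNReal.ofReal (4 ^ n) * volume (closedBall z.1.1 z.1.2) := fun z =>
        vol_mul _ _ (by norm_num) (hut z.2).2.1.le
      have e2 : ENNReal.ofReal (cT n * M) * ∑' z : u, volume (closedBall z.1.1 z.1.2) ≤
          ENNReal.ofReal (cA n * M) * volume (closedBall x r) := by
        calc _ = ∑' z : u, ENNReal.ofReal (cT n * M) * volume (closedBall z.1.1 z.1.2) :=
              ENNReal.tsum_mul_left.symm
          _ ≤ ∑' z : u, ∫⁻ y in closedBall z.1.1 z.1.2, ‖b y - a‖ₑ := by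
            refine ENNReal.tsum_le_tsum fun z => ?_
            refine le_trans ?_ (av_sub_mul_le hb z.1.1 (hut z.2).2.1 a)
            gcongr
            rw [Real.enorm_eq_ofReal_abs]
            exact ENNReal.ofReal_le_ofReal (hut z.2).2.2.2.1.le
          _ = ∫⁻ y in ⋃ z ∈ u, closedBall z.1 z.2, ‖b y - a‖ₑ :=
            (lintegral_biUnion hcount (fun z _ => measurableSet_closedBall) hdisj _).symm
          _ ≤ ∫⁻ y in closedBall x (2 * r), ‖b y - a‖ₑ := by
            refine lintegral_mono_set (iUnion₂_subset fun z hz => ?_)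
            refine closedBall_subset_closedBall' ?_
            have h1 := mem_closedBall.1 (hut hz).1
            have h2 := (hut hz).2.2.1
            linarith
          _ ≤ _ := osc_double hM.le hb H x hr
      have e3 : ENNReal.ofReal (cT n * M) = ENNReal.ofReal (cA n * M) *
          (2 * ENNReal.ofReal (4 ^ n)) := by
        have : cT n * M = (cA n * M) * (2 * 4 ^ n) := by unfold cT; ring
        rw [this, ENNReal.ofReal_mul (p := cA n * M) (mul_nonneg (cA_pos n).le hM.le),
          ENNReal.ofReal_mul (p := 2) (by norm_num), ENNReal.ofReal_ofNat]
      rw [e3, mul_assoc, ENNReal.mul_le_mul_iff_right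
        (ENNReal.ofReal_pos.2 (mul_pos (cA_pos n) hM)).ne' ENNReal.ofReal_ne_top] at e2
      simp_rw [e1]
      rw [ENNReal.tsum_mul_left, ← mul_assoc]
      exact e2
    have hsub : ({y | y ∈ closedBall x r ∧ ((m + 1 : ℕ) : ℝ) * (cK n * M) < |b y - a|} : Set _)
        ≤ᵐ[volume] (⋃ z ∈ u, {y | y ∈ closedBall z.1 (4 * z.2) ∧
          m * (cK n * M) < |b y - av b z.1 (4 * z.2)|} : Set _) := by
      filter_upwards [stopping hM.le hb H x hr] with y hy
      rintro ⟨hyB, hyK⟩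
      have hKM : 0 < cK n * M := mul_pos (cK_pos n) hM
      have hK : cK n * M = cT n * M + 2 ^ n * M := by unfold cK; ring
      have h2M : 0 < 2 ^ n * M := by positivity
      push_cast at hyK
      have hm0 : 0 ≤ (m : ℝ) * (cK n * M) := by positivity
      obtain ⟨ρ, h1, h2, h3, h4⟩ := hy hyB (by nlinarith)
      obtain ⟨z, hz, hzsub⟩ := hcov (y, ρ) ⟨hyB, h1, h2, h3, h4⟩
      refine mem_iUnion₂.2 ⟨z, hz, hzsub (mem_closedBall_self h1.le), ?_⟩
      have h5 := (hut hz).2.2.2.2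
      have hz0 := (hut hz).2.1
      have h6 := av_compare (s := 2 * z.2) hM.le hb H z.1 z.1 (by positivity)
        (closedBall_subset_closedBall (by linarith))
      rw [← mul_assoc, show (2:ℝ) * 2 = 4 by norm_num] at h6
      have h7 : |b y - a| ≤ |b y - av b z.1 (4 * z.2)| + |av b z.1 (2 * z.2) - av b z.1 (4 * z.2)|
          + |av b z.1 (2 * z.2) - a| := by
        have e : b y - a = (b y - av b z.1 (4 * z.2)) - (av b z.1 (2 * z.2) - av b z.1 (4 * z.2))
          + (av b z.1 (2 * z.2) - a) := by ring
        rw [e]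
        exact (abs_add_le _ _).trans (add_le_add (abs_sub _ _) le_rfl)
      nlinarith
    calc _ ≤ volume (⋃ z ∈ u, {y | y ∈ closedBall z.1 (4 * z.2) ∧
          m * (cK n * M) < |b y - av b z.1 (4 * z.2)|}) := measure_mono_ae hsub
      _ ≤ ∑' z : u, volume {y | y ∈ closedBall z.1.1 (4 * z.1.2) ∧
          m * (cK n * M) < |b y - av b z.1.1 (4 * z.1.2)|} := measure_biUnion_le _ hcount _
      _ ≤ ∑' z : u, (2⁻¹ : ℝ≥0∞) ^ m * volume (closedBall z.1.1 (4 * z.1.2)) :=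
        ENNReal.tsum_le_tsum fun z => ih _ _ (by have := (hut z.2).2.1; positivity)
      _ = (2⁻¹ : ℝ≥0∞) ^ (m + 1) * (2 * ∑' z : u, volume (closedBall z.1.1 (4 * z.1.2))) := by
        rw [ENNReal.tsum_mul_left, pow_succ, mul_assoc, ← mul_assoc 2⁻¹,
          ENNReal.inv_mul_cancel (by norm_num) (by norm_num), one_mul]
      _ ≤ _ := by gcongr

noncomputable def cS (p : ℝ) : ℝ≥0∞ := ∑' m : ℕ, ENNReal.ofReal (((m : ℝ) + 1) ^ p) * 2⁻¹ ^ m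

lemma cS_ne_top (p : ℝ) : cS p ≠ ⊤ := by
  obtain ⟨N, hN⟩ := exists_nat_ge p
  have h1 : Summable fun m : ℕ => ((m : ℝ) ^ N * (1 / 2 : ℝ) ^ m) :=
    summable_pow_mul_geometric_of_norm_lt_one N (by norm_num)
  have h2 := ((summable_nat_add_iff 1).2 h1).mul_left 2
  refine ne_top_of_le_ne_top h2.tsum_ofReal_ne_top (ENNReal.tsum_le_tsum fun m => ?_)
  have h3 : (2⁻¹ : ℝ≥0∞) ^ m = ENNReal.ofReal ((1 / 2 : ℝ) ^ m) := by
    rw [ENNReal.ofReal_pow (by norm_num)]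
    congr 1
    rw [one_div, ENNReal.ofReal_inv_of_pos (by norm_num), ENNReal.ofReal_ofNat]
  rw [h3, ← ENNReal.ofReal_mul (by positivity)]
  refine ENNReal.ofReal_le_ofReal ?_
  have h4 : ((m : ℝ) + 1) ^ p ≤ ((m : ℝ) + 1) ^ N := by
    rw [← Real.rpow_natCast]
    exact Real.rpow_le_rpow_of_exponent_le (by linarith [m.cast_nonneg (α := ℝ)]) hN
  calc _ ≤ ((m : ℝ) + 1) ^ N * (1 / 2) ^ m := by gcongr
    _ = _ := by push_cast; ring

lemma jn_pos {b : EuclideanSpace ℝ (Fin n) → ℝ} {M : ℝ} (hM : 0 < M)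
    (hb : LocallyIntegrable b volume) (H : IsBMO b M) {p : ℝ} (hp : 1 < p)
    (x : EuclideanSpace ℝ (Fin n)) {r : ℝ} (hr : 0 < r) :
    ∫⁻ y in closedBall x r, ‖b y - av b x r‖ₑ ^ p ≤
      ENNReal.ofReal (cK n * M) ^ p * cS p * volume (closedBall x r) := by
  have hp0 : 0 < p := by linarith
  have hKM : 0 < cK n * M := mul_pos (cK_pos n) hM
  let E : ℕ → Set (EuclideanSpace ℝ (Fin n)) := fun m => {y | m * (cK n * M) < |b y - av b x r|}
  have hE : ∀ m, NullMeasurableSet (E m) (volume.restrict (closedBall x r)) := fun m =>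
    nullMeasurableSet_lt aemeasurable_const
      (continuous_abs.measurable.comp_aemeasurable
        (hb.aestronglyMeasurable.aemeasurable.restrict.sub_const _))
  have hpt : ∀ y, ‖b y - av b x r‖ₑ ^ p ≤ ∑' m : ℕ, (E m).indicator
      (fun _ => ENNReal.ofReal (cK n * M) ^ p * ENNReal.ofReal (((m : ℝ) + 1) ^ p)) y := by
    intro y
    rcases (abs_nonneg (b y - av b x r)).eq_or_lt with h0 | h0
    · rw [Real.enorm_eq_ofReal_abs, ← h0]
      simp [hp0]
    · set w := |b y - av b x r| with hw
      have hq : 0 < w / (cK n * M) := by positivity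
      obtain ⟨m, hm⟩ : ∃ m, ⌈w / (cK n * M)⌉₊ = m + 1 :=
        Nat.exists_eq_succ_of_ne_zero (Nat.ceil_pos.2 hq).ne'
      have h1 : w ≤ (m + 1) * (cK n * M) := by
        rw [← div_le_iff₀ hKM]
        have := Nat.le_ceil (w / (cK n * M))
        rw [hm] at this
        exact_mod_cast this
      have h2 : m * (cK n * M) < w := by
        rw [← lt_div_iff₀ hKM]
        exact Nat.lt_ceil.1 (by omega)
      refine le_trans ?_ (ENNReal.le_tsum m)
      rw [indicator_of_mem (show y ∈ E m from h2), Real.enorm_eq_ofReal_abs, ← hw,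
        ← ENNReal.ofReal_rpow_of_pos (by positivity), ← ENNReal.mul_rpow_of_nonneg _ _ hp0.le,
        ← ENNReal.ofReal_mul hKM.le]
      gcongr
      linarith
  calc _ ≤ ∫⁻ y in closedBall x r, ∑' m : ℕ, (E m).indicator
          (fun _ => ENNReal.ofReal (cK n * M) ^ p * ENNReal.ofReal (((m : ℝ) + 1) ^ p)) y :=
        lintegral_mono hpt
    _ = ∑' m : ℕ, ∫⁻ y in closedBall x r, (E m).indicator
          (fun _ => ENNReal.ofReal (cK n * M) ^ p * ENNReal.ofReal (((m : ℝ) + 1) ^ p)) y :=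
        lintegral_tsum fun m => (aemeasurable_const.indicator₀ (hE m))
    _ ≤ ∑' m : ℕ, ENNReal.ofReal (cK n * M) ^ p * ENNReal.ofReal (((m : ℝ) + 1) ^ p) *
        (2⁻¹ ^ m * volume (closedBall x r)) := by
      refine ENNReal.tsum_le_tsum fun m => ?_
      rw [lintegral_indicator_const₀ (hE m),
        Measure.restrict_apply' measurableSet_closedBall]
      gcongr
      refine le_trans (measure_mono ?_) (decay hM hb H m x r hr)
      rintro y ⟨h1, h2⟩
      exact ⟨h2, h1⟩
    _ = _ := by
      rw [cS, ← ENNReal.tsum_mul_left, ← ENNReal.tsum_mul_right]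
      refine tsum_congr fun m => ?_
      ring

lemma jn {b : EuclideanSpace ℝ (Fin n) → ℝ} {M : ℝ} (hM : 0 ≤ M)
    (hb : LocallyIntegrable b volume) (H : IsBMO b M) {p : ℝ} (hp : 1 < p)
    (x : EuclideanSpace ℝ (Fin n)) {r : ℝ} (hr : 0 < r) :
    (∫⁻ y in closedBall x r, ‖b y - av b x r‖ₑ ^ p) ^ (1 / p) ≤
      (ENNReal.ofReal (cK n) * cS p ^ (1 / p)) * ENNReal.ofReal M *
        volume (closedBall x r) ^ (1 / p) := by
  have hp0 : 0 < p := by linarith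
  rcases hM.eq_or_lt with h0 | h0
  · have h1 := H x r hr
    rw [← h0] at h1
    simp only [ENNReal.ofReal_zero, zero_mul, nonpos_iff_eq_zero] at h1
    have hme : AEMeasurable (fun y => ‖b y - av b x r‖ₑ) (volume.restrict (closedBall x r)) :=
      (hb.aestronglyMeasurable.sub aestronglyMeasurable_const).enorm.restrict
    rw [lintegral_eq_zero_iff' hme] at h1
    have h2 : ∫⁻ y in closedBall x r, ‖b y - av b x r‖ₑ ^ p = 0 := by
      rw [← lintegral_zero (μ := volume.restrict (closedBall x r))]
      refine lintegral_congr_ae ?_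
      filter_upwards [h1] with y hy
      simp only [Pi.zero_apply] at hy
      rw [hy, ENNReal.zero_rpow_of_pos hp0]
    rw [h2, ENNReal.zero_rpow_of_pos (by positivity)]
    exact zero_le
  · refine (ENNReal.rpow_le_rpow (jn_pos h0 hb H hp x hr) (by positivity)).trans (le_of_eq ?_)
    rw [ENNReal.mul_rpow_of_nonneg _ _ (by positivity), ENNReal.mul_rpow_of_nonneg _ _ (by positivity),
      ← ENNReal.rpow_mul, mul_one_div_cancel hp0.ne', ENNReal.rpow_one,
      ENNReal.ofReal_mul (cK_pos n).le]
    ring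

lemma holder' {α : Type*} [MeasurableSpace α] (μ : Measure α) {p q : ℝ}
    (hpq : p.HolderConjugate q) {g h : α → ℝ≥0∞} (hg : AEMeasurable g μ) (hgt : ∀ a, g a ≠ ⊤) :
    ∫⁻ a, g a * h a ∂μ ≤ (∫⁻ a, g a ^ p ∂μ) ^ (1 / p) * (∫⁻ a, h a ^ q ∂μ) ^ (1 / q) := by
  obtain ⟨w, hw, hwle, hwe⟩ := exists_measurable_le_lintegral_eq μ (fun a => g a * h a)
  have h1 : ∀ a, w a = g a * (w a / g a) := by
    intro a
    by_cases h0 : g a = 0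
    · have := hwle a
      simp only [h0, zero_mul, nonpos_iff_eq_zero] at this
      simp [h0, this]
    · rw [ENNReal.mul_div_cancel h0 (hgt a)]
  have h2 : ∀ a, w a / g a ≤ h a := fun a =>
    ENNReal.div_le_of_le_mul ((hwle a).trans_eq (mul_comm _ _))
  rw [hwe]
  calc ∫⁻ a, w a ∂μ = ∫⁻ a, (g * fun a => w a / g a) a ∂μ := lintegral_congr h1
    _ ≤ _ := ENNReal.lintegral_mul_le_Lp_mul_Lq μ hpq hg (hw.aemeasurable.div hg)
    _ ≤ _ := by
      have := hpq.symm.nonneg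
      gcongr with a
      exact h2 a

lemma mink {α : Type*} [MeasurableSpace α] (μ : Measure α) {p : ℝ} (hp : 1 < p)
    {g : α → ℝ≥0∞} (hg : AEMeasurable g μ) (c : ℝ≥0∞) :
    (∫⁻ a, (g a + c) ^ p ∂μ) ^ (1 / p) ≤ (∫⁻ a, g a ^ p ∂μ) ^ (1 / p) + c * μ univ ^ (1 / p) := by
  have hp0 : 0 < p := by linarith
  refine (ENNReal.lintegral_Lp_add_le (f := g) (g := fun _ => c) hg aemeasurable_const hp.le).trans
    (le_of_eq ?_)
  rw [lintegral_const, ENNReal.mul_rpow_of_nonneg _ _ (by positivity), ← ENNReal.rpow_mul,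
    mul_one_div_cancel hp0.ne', ENNReal.rpow_one]

lemma av_chain {b : EuclideanSpace ℝ (Fin n) → ℝ} {M : ℝ} (hM : 0 ≤ M)
    (hb : LocallyIntegrable b volume) (H : IsBMO b M) (j : ℤ) (i : ℕ) :
    |av b 0 ((2:ℝ) ^ j) - av b 0 ((2:ℝ) ^ (j + i))| ≤ i * (2 ^ n * M) := by
  induction i with
  | zero => simp
  | succ i ih =>
    have h := av_compare (s := (2:ℝ) ^ (j + i)) hM hb H 0 0 (by positivity)
      (closedBall_subset_closedBall (by linarith [show (0:ℝ) < 2 ^ (j + i) by positivity]))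
    have e : (2:ℝ) * 2 ^ (j + i) = 2 ^ (j + ((i + 1 : ℕ) : ℤ)) := by
      rw [Nat.cast_succ, ← add_assoc, zpow_add_one₀ (by norm_num)]; ring
    rw [e] at h
    refine (abs_sub_le _ (av b 0 ((2:ℝ) ^ (j + i))) _).trans ?_
    push_cast at *
    linarith

lemma V_mul (k : ℤ) (m : ℕ) : volume (closedBall (0 : EuclideanSpace ℝ (Fin n)) ((2:ℝ) ^ (k + m)))
    = (2:ℝ≥0∞) ^ ((m:ℝ) * n) * volume (closedBall (0 : EuclideanSpace ℝ (Fin n)) ((2:ℝ) ^ k)) := by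
  rw [zpow_add₀ (by norm_num), mul_comm, vol_mul (0 : EuclideanSpace ℝ (Fin n)) 0 (by positivity)
    (by positivity)]
  congr 1
  rw [zpow_natCast, ← pow_mul, ENNReal.ofReal_pow (by norm_num), ENNReal.ofReal_ofNat,
    ← ENNReal.rpow_natCast]
  push_cast
  rfl

lemma enorm_abs' (a : ℝ) : ‖|a|‖ₑ = ‖a‖ₑ := by
  rw [Real.enorm_eq_ofReal_abs, abs_abs, ← Real.enorm_eq_ofReal_abs]

lemma pointwise {b f : EuclideanSpace ℝ (Fin n) → ℝ} (hb : LocallyIntegrable b volume)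
    {p q : ℝ} (hpq : p.HolderConjugate q) {j k : ℤ} (hjk : j ≤ k - 3)
    (hf : Function.support f ⊆ annulus n j)
    {x : EuclideanSpace ℝ (Fin n)} (hx : x ∈ annulus n k) :
    ‖maxComm n b f x‖ₑ ≤
      (volume (closedBall (0 : EuclideanSpace ℝ (Fin n)) ((2:ℝ) ^ (k - 2))))⁻¹ *
      ((∫⁻ y in closedBall 0 ((2:ℝ) ^ j), ‖b x - b y‖ₑ ^ p) ^ (1 / p) *
        (∫⁻ y, ‖f y‖ₑ ^ q) ^ (1 / q)) := by
  have hq0 : 0 ≤ q := hpq.symm.nonneg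
  set R := (volume (closedBall (0 : EuclideanSpace ℝ (Fin n)) ((2:ℝ) ^ (k - 2))))⁻¹ *
      ((∫⁻ y in closedBall 0 ((2:ℝ) ^ j), ‖b x - b y‖ₑ ^ p) ^ (1 / p) *
        (∫⁻ y, ‖f y‖ₑ ^ q) ^ (1 / q)) with hR
  have hterm : ∀ r : {r : ℝ // 0 < r}, ENNReal.ofReal (((volume (Metric.ball x r.1)).toReal)⁻¹ *
    ∫ y in Metric.ball x r.1, |b x - b y| * |f y|) ≤ R := by
    rintro ⟨r, hr⟩
    simp only
    by_cases hr2 : (2:ℝ) ^ (k - 2) < r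
    · have hv0 : volume (ball x r) ≠ 0 := (measure_ball_pos volume x hr).ne'
      have hvt : volume (ball x r) ≠ ⊤ := measure_ball_lt_top.ne
      rw [ENNReal.ofReal_mul (by positivity), ENNReal.ofReal_inv_of_pos
        (ENNReal.toReal_pos hv0 hvt), ENNReal.ofReal_toReal hvt]
      refine mul_le_mul' ?_ ?_
      · rw [← Measure.addHaar_closedBall_center volume x]
        exact ENNReal.inv_le_inv.2 (measure_mono (closedBall_subset_ball hr2))
      · calc _ ≤ ‖∫ y in Metric.ball x r, |b x - b y| * |f y|‖ₑ := by
              rw [Real.enorm_eq_ofReal_abs]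
              exact ENNReal.ofReal_le_ofReal (le_abs_self _)
          _ ≤ ∫⁻ y in Metric.ball x r, ‖|b x - b y| * |f y|‖ₑ :=
            enorm_integral_le_lintegral_enorm _
          _ ≤ ∫⁻ y, ‖|b x - b y| * |f y|‖ₑ := setLIntegral_le_lintegral _ _
          _ = ∫⁻ y, (closedBall 0 ((2:ℝ) ^ j)).indicator (fun y => ‖b x - b y‖ₑ * ‖f y‖ₑ) y := by
            refine lintegral_congr fun y => ?_
            rw [enorm_mul, enorm_abs', enorm_abs']
            by_cases hy : y ∈ closedBall (0 : EuclideanSpace ℝ (Fin n)) ((2:ℝ) ^ j)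
            · rw [indicator_of_mem hy]
            · rw [indicator_of_notMem hy]
              have : f y = 0 := by
                by_contra h0
                exact hy (mem_closedBall_zero_iff.2 (hf h0).2)
              simp [this]
          _ = ∫⁻ y in closedBall 0 ((2:ℝ) ^ j), ‖b x - b y‖ₑ * ‖f y‖ₑ :=
            lintegral_indicator measurableSet_closedBall _
          _ ≤ (∫⁻ y in closedBall 0 ((2:ℝ) ^ j), ‖b x - b y‖ₑ ^ p) ^ (1 / p) *
              (∫⁻ y in closedBall 0 ((2:ℝ) ^ j), ‖f y‖ₑ ^ q) ^ (1 / q) :=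
            holder' _ hpq
              (aestronglyMeasurable_const.sub hb.aestronglyMeasurable).enorm.restrict
              (fun _ => enorm_ne_top)
          _ ≤ _ := by
            gcongr
            exact Measure.restrict_le_self
    · have : ∫ y in Metric.ball x r, |b x - b y| * |f y| = 0 := by
        rw [← integral_zero (EuclideanSpace ℝ (Fin n)) ℝ (μ := volume.restrict (ball x r))]
        refine setIntegral_congr_fun measurableSet_ball fun y hy => ?_
        have h0 : f y = 0 := by
          by_contra h0
          have h1 := (hf h0).2
          have h2 := hx.1
          have h3 := mem_ball.1 hy
          rw [dist_eq_norm] at h3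
          have h4 : ‖x‖ ≤ ‖y - x‖ + ‖y‖ := by
            have := norm_sub_le y (y - x)
            simp only [_root_.sub_sub_cancel] at this
            linarith
          have h5 : (2:ℝ) ^ j ≤ 2 ^ (k - 2) := zpow_le_zpow_right₀ (by norm_num) (by omega)
          have h6 : (2:ℝ) ^ (k - 1) = 2 ^ (k - 2) * 2 := by
            rw [← zpow_add_one₀ (by norm_num)]; congr 1; ring
          linarith
        simp [h0]
      rw [this]
      simp
  by_cases hRt : R = ⊤
  · rw [hRt]; exact le_top
  · have h0 : 0 ≤ maxComm n b f x := Real.iSup_nonneg fun r => by positivity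
    rw [Real.enorm_eq_ofReal h0]
    refine ENNReal.ofReal_le_of_le_toReal ?_
    have : Nonempty {r : ℝ // 0 < r} := ⟨⟨1, one_pos⟩⟩
    exact ciSup_le fun r => (ENNReal.ofReal_le_iff_le_toReal hRt).1 (hterm r)

noncomputable def cJ (n : ℕ) (p : ℝ) : ℝ≥0∞ := ENNReal.ofReal (cK n) * cS p ^ (1 / p)

lemma cJ_ne_top (n : ℕ) {p : ℝ} (hp : 1 < p) : cJ n p ≠ ⊤ :=
  ENNReal.mul_ne_top ENNReal.ofReal_ne_top
    (ENNReal.rpow_ne_top_of_nonneg (by positivity) (cS_ne_top p))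


lemma inner_bound {b : EuclideanSpace ℝ (Fin n) → ℝ} {M : ℝ} (hM : 0 ≤ M)
    (hb : LocallyIntegrable b volume) (H : IsBMO b M) {p : ℝ} (hp : 1 < p)
    (x z : EuclideanSpace ℝ (Fin n)) {r : ℝ} (hr : 0 < r) :
    (∫⁻ y in closedBall z r, ‖b x - b y‖ₑ ^ p) ^ (1 / p) ≤
      volume (closedBall z r) ^ (1 / p) * (‖b x - av b z r‖ₑ + cJ n p * ENNReal.ofReal M) := by
  have hp0 : 0 < p := by linarith
  calc _ ≤ (∫⁻ y in closedBall z r, (‖b y - av b z r‖ₑ + ‖b x - av b z r‖ₑ) ^ p) ^ (1 / p) := by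
        gcongr with y
        have e : b x - b y = (b x - av b z r) - (b y - av b z r) := by ring
        rw [e, add_comm]
        exact enorm_sub_le
    _ ≤ _ := mink _ hp
      (hb.aestronglyMeasurable.sub aestronglyMeasurable_const).enorm.restrict _
    _ ≤ cJ n p * ENNReal.ofReal M * volume (closedBall z r) ^ (1 / p) +
        ‖b x - av b z r‖ₑ * volume (closedBall z r) ^ (1 / p) := by
      rw [Measure.restrict_apply_univ]
      gcongr
      exact jn hM hb H hp z hr
    _ = _ := by ring

lemma outer_bound {b : EuclideanSpace ℝ (Fin n) → ℝ} {M : ℝ} (hM : 0 ≤ M)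
    (hb : LocallyIntegrable b volume) (H : IsBMO b M) {q : ℝ} (hq : 1 < q)
    (z : EuclideanSpace ℝ (Fin n)) {r : ℝ} (hr : 0 < r) (c : ℝ) (D L : ℝ≥0∞)
    (hL : ‖c - av b z r‖ₑ ≤ L) :
    (∫⁻ y in closedBall z r, (‖b y - c‖ₑ + D) ^ q) ^ (1 / q) ≤
      (cJ n q * ENNReal.ofReal M + (L + D)) * volume (closedBall z r) ^ (1 / q) := by
  have hq0 : 0 < q := by linarith
  calc _ ≤ (∫⁻ y in closedBall z r, (‖b y - av b z r‖ₑ + (L + D)) ^ q) ^ (1 / q) := by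
        refine ENNReal.rpow_le_rpow (lintegral_mono fun y => ENNReal.rpow_le_rpow ?_ hq0.le)
          (by positivity)
        rw [← add_assoc]
        refine add_le_add ?_ le_rfl
        have e : b y - c = (b y - av b z r) - (c - av b z r) := by ring
        rw [e]
        exact enorm_sub_le.trans (by gcongr)
    _ ≤ _ := mink _ hq
      (hb.aestronglyMeasurable.sub aestronglyMeasurable_const).enorm.restrict _
    _ ≤ cJ n q * ENNReal.ofReal M * volume (closedBall z r) ^ (1 / q) +
        (L + D) * volume (closedBall z r) ^ (1 / q) := by
      rw [Measure.restrict_apply_univ]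
      gcongr
      exact jn hM hb H hq z hr
    _ = _ := by ring

lemma vol_factor {p q : ℝ} (hpq : p.HolderConjugate q) (j : ℤ) (i : ℕ) :
    (volume (closedBall (0 : EuclideanSpace ℝ (Fin n)) ((2:ℝ) ^ (j + i - 2))))⁻¹ *
      (volume (closedBall (0 : EuclideanSpace ℝ (Fin n)) ((2:ℝ) ^ j)) ^ (1 / p) *
       volume (closedBall (0 : EuclideanSpace ℝ (Fin n)) ((2:ℝ) ^ (j + i))) ^ (1 / q)) =
      (2:ℝ≥0∞) ^ ((2:ℝ) * n) * (2:ℝ≥0∞) ^ (-(i:ℝ) * n * (1 - 1 / q)) := by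
  have h1 := V_mul (n := n) j i
  have h2 := V_mul (n := n) (j + i - 2) 2
  have hp1 : 0 < 1 / p := by have := hpq.pos; positivity
  have hq1 : 0 < 1 / q := by have := hpq.symm.pos; positivity
  have hsum : 1 / p + 1 / q = 1 := by simpa using hpq.inv_add_inv_eq_one
  have hk : j + (i:ℤ) - 2 + ((2:ℕ):ℤ) = j + i := by push_cast; ring
  rw [hk] at h2
  set W := volume (closedBall (0 : EuclideanSpace ℝ (Fin n)) ((2:ℝ) ^ (j + i - 2)))
  set Vj := volume (closedBall (0 : EuclideanSpace ℝ (Fin n)) ((2:ℝ) ^ j))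
  set Vk := volume (closedBall (0 : EuclideanSpace ℝ (Fin n)) ((2:ℝ) ^ (j + i)))
  have hW0 : W ≠ 0 := vol_pos _ (by positivity)
  have hWt : W ≠ ⊤ := vol_top _
  have hV0 : Vk ≠ 0 := vol_pos _ (by positivity)
  have hVt : Vk ≠ ⊤ := vol_top _
  have h3 : Vj = (2:ℝ≥0∞) ^ (-(i:ℝ) * n) * Vk := by
    rw [h1, ← mul_assoc, ← ENNReal.rpow_add _ _ (by norm_num) (by norm_num)]
    simp
  have h4 : 1 - 1 / q = 1 / p := by linarith
  rw [h4, h3, ENNReal.mul_rpow_of_nonneg _ _ hp1.le, mul_assoc, ← ENNReal.rpow_add _ _ hV0 hVt,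
    hsum, ENNReal.rpow_one, ← ENNReal.rpow_mul, h2]
  push_cast
  generalize (2:ℝ≥0∞) ^ (-(i:ℝ) * n * (1 / p)) = X
  generalize (2:ℝ≥0∞) ^ ((2:ℝ) * n) = Y
  calc W⁻¹ * (X * (Y * W)) = Y * X * (W * W⁻¹) := by ring
    _ = Y * X := by rw [ENNReal.mul_inv_cancel hW0 hWt, mul_one]

lemma main {q : ℝ} (hq : 1 < q) {b f : EuclideanSpace ℝ (Fin n) → ℝ} {M : ℝ} (hM : 0 ≤ M)
    (hb : LocallyIntegrable b volume) (H : IsBMO b M) (j : ℤ) (i : ℕ) (hi : 3 ≤ i)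
    (hf : Function.support f ⊆ annulus n j) :
    eLpNorm ((annulus n (j + i)).indicator (maxComm n b f)) (ENNReal.ofReal q) volume ≤
      ((2:ℝ≥0∞) ^ ((2:ℝ) * n) * (cJ n q + (ENNReal.ofReal (2 ^ n) + cJ n q.conjExponent))) *
        ENNReal.ofReal M * ENNReal.ofReal i * (2:ℝ≥0∞) ^ (-(i:ℝ) * n * (1 - 1/q)) *
        eLpNorm f (ENNReal.ofReal q) volume := by
  have hq0 : 0 < q := by linarith
  have hqp := Real.HolderConjugate.conjExponent hq
  set p := q.conjExponent
  have hp : 1 < p := hqp.symm.lt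
  rw [eLpNorm_eq_lintegral_rpow_enorm_toReal (by simpa using hq0) ENNReal.ofReal_ne_top,
    eLpNorm_eq_lintegral_rpow_enorm_toReal (by simpa using hq0) ENNReal.ofReal_ne_top,
    ENNReal.toReal_ofReal hq0.le]
  set F := (∫⁻ y, ‖f y‖ₑ ^ q) ^ (1 / q) with hF
  have hvf := vol_factor (n := n) hqp.symm j i
  set W := volume (closedBall (0 : EuclideanSpace ℝ (Fin n)) ((2:ℝ) ^ (j + i - 2)))
  set P := volume (closedBall (0 : EuclideanSpace ℝ (Fin n)) ((2:ℝ) ^ j)) ^ (1 / p) with hP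
  set Q := volume (closedBall (0 : EuclideanSpace ℝ (Fin n)) ((2:ℝ) ^ (j + i))) ^ (1 / q) with hQ
  set c := av b 0 ((2:ℝ) ^ j) with hc
  set D := cJ n p * ENNReal.ofReal M with hD
  set L := ENNReal.ofReal (i * (2 ^ n * M)) with hL
  set B := closedBall (0 : EuclideanSpace ℝ (Fin n)) ((2:ℝ) ^ (j + i)) with hB
  have hpt : ∀ x, ‖(annulus n (j + i)).indicator (maxComm n b f) x‖ₑ ^ q ≤
      B.indicator (fun x => (W⁻¹ * P * F) ^ q * (‖b x - c‖ₑ + D) ^ q) x := by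
    intro x
    by_cases hx : x ∈ annulus n (j + i)
    · rw [indicator_of_mem hx, indicator_of_mem (mem_closedBall_zero_iff.2 hx.2),
        ← ENNReal.mul_rpow_of_nonneg _ _ hq0.le]
      gcongr
      refine (pointwise hb hqp.symm (by omega) hf hx).trans ?_
      calc _ ≤ W⁻¹ * ((P * (‖b x - c‖ₑ + D)) * F) := by
            gcongr
            exact inner_bound hM hb H hp x 0 (by positivity)
        _ = _ := by ring
    · rw [indicator_of_notMem hx]
      simp [hq0]
  have hmeas : AEMeasurable (fun x => (‖b x - c‖ₑ + D) ^ q) (volume.restrict B) :=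
    ((((hb.aestronglyMeasurable.sub aestronglyMeasurable_const).enorm.restrict).add_const
      D).pow_const q)
  have hLc : ‖c - av b 0 ((2:ℝ) ^ (j + i))‖ₑ ≤ L := by
    rw [Real.enorm_eq_ofReal_abs]
    exact ENNReal.ofReal_le_ofReal (av_chain hM hb H j i)
  have hi1 : (1:ℝ≥0∞) ≤ ENNReal.ofReal i := by
    rw [← ENNReal.ofReal_one]
    exact ENNReal.ofReal_le_ofReal (by exact_mod_cast (by omega : 1 ≤ i))
  calc _ ≤ (∫⁻ x, B.indicator (fun x => (W⁻¹ * P * F) ^ q * (‖b x - c‖ₑ + D) ^ q) x) ^ (1 / q) := by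
        gcongr with x
        exact hpt x
    _ = (W⁻¹ * P * F) * (∫⁻ x in B, (‖b x - c‖ₑ + D) ^ q) ^ (1 / q) := by
      rw [lintegral_indicator measurableSet_closedBall, lintegral_const_mul'' _ hmeas,
        ENNReal.mul_rpow_of_nonneg _ _ (by positivity), ← ENNReal.rpow_mul,
        mul_one_div_cancel hq0.ne', ENNReal.rpow_one]
    _ ≤ (W⁻¹ * P * F) * ((cJ n q * ENNReal.ofReal M + (L + D)) * Q) := by
      gcongr
      exact outer_bound hM hb H hq 0 (by positivity) c D L hLc
    _ = (W⁻¹ * (P * Q)) * (cJ n q * ENNReal.ofReal M * 1 + (L + D * 1)) * F := by ring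
    _ ≤ (W⁻¹ * (P * Q)) * (cJ n q * ENNReal.ofReal M * ENNReal.ofReal i +
          (L + D * ENNReal.ofReal i)) * F := by gcongr
    _ = _ := by
      rw [hvf, hL, hD, ENNReal.ofReal_mul (by positivity), ENNReal.ofReal_mul (by positivity)]
      ring

end JN

/-- Annulus estimate for the maximal commutator, far-off-diagonal case `j ≤ k-3`:
`‖(M_b f) χ_{A_k}‖_{L^q} ≤ C M (k-j) 2^{(j-k)n(1-1/q)} ‖f‖_{L^q}`. -/
theorem stmt_16 (n : ℕ) (q : ℝ) (hq : 1 < q) :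
    ∃ C : ℝ≥0∞, 0 < C ∧ C ≠ ⊤ ∧
      ∀ (b : EuclideanSpace ℝ (Fin n) → ℝ) (M : ℝ),
      LocallyIntegrable b volume →
      (∀ (x : EuclideanSpace ℝ (Fin n)) (r : ℝ), 0 < r →
        ⨍ y in Metric.ball x r, |b y - ⨍ z in Metric.ball x r, b z| ≤ M) →
      ∀ (j k : ℤ), j ≤ k - 3 →
      ∀ f : EuclideanSpace ℝ (Fin n) → ℝ, Function.support f ⊆ annulus n j →
        eLpNorm ((annulus n k).indicator (maxComm n b f)) (ENNReal.ofReal q) volume ≤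
          C * ENNReal.ofReal M * ENNReal.ofReal ((k : ℝ) - (j : ℝ)) *
            (2:ℝ≥0∞) ^ (((j:ℝ) - (k:ℝ)) * n * (1 - 1/q)) *
            eLpNorm f (ENNReal.ofReal q) volume := by
  have hq1 := (Real.HolderConjugate.conjExponent hq).symm.lt
  refine ⟨(2:ℝ≥0∞) ^ ((2:ℝ) * n) *
    (JN.cJ n q + (ENNReal.ofReal (2 ^ n) + JN.cJ n q.conjExponent)), ?_, ?_, ?_⟩
  · refine ENNReal.mul_pos (ENNReal.rpow_pos (by norm_num) (by norm_num)).ne' ?_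
    have : 0 < ENNReal.ofReal ((2:ℝ) ^ n) := ENNReal.ofReal_pos.2 (by positivity)
    simp [this.ne']
  · refine ENNReal.mul_ne_top (ENNReal.rpow_ne_top_of_nonneg (by positivity) (by norm_num)) ?_
    exact ENNReal.add_ne_top.2 ⟨JN.cJ_ne_top n hq,
      ENNReal.add_ne_top.2 ⟨ENNReal.ofReal_ne_top, JN.cJ_ne_top n hq1⟩⟩
  · intro b M hb h j k hjk f hf
    obtain ⟨i, hi⟩ : ∃ i : ℕ, k = j + i := ⟨(k - j).toNat, by omega⟩
    subst hi
    have := JN.main hq (JN.M_nonneg h) hb (JN.isBMO_of hb h) j i (by omega) hf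
    have e1 : (((j + i : ℤ) : ℝ) - (j : ℝ)) = i := by push_cast; ring
    have e2 : ((j : ℝ) - ((j + i : ℤ) : ℝ)) = -i := by push_cast; ring
    rw [e1, e2]
    exact this
end
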